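/- arXiv:1302.5651 — 2 statements merged into one kernel-verified Lean document; each statement's English description precedes it below -/
import Mathlib

section
/- Let K be a tame family of compact subsets of a strongly locally homogeneous completely metrizable space X, and let A and B be dense K-tame decompositions of X. Then the set of (A,B)-liftable homeomorphisms is dense in the space H(X/A, X/B) of all homeomorphisms between the decomposition spaces, endowed with the limitation topology. -/
open Set Topology unitInterval

noncomputable section

/-! ### General notions -/

/-- `X` is completely metrizable: its topology is generated by a complete metric. -/
def CompletelyMetrizable (X : Type*) [t : TopologicalSpace X] : Prop :=
  ∃ m : MetricSpace X, m.toUniformSpace.toTopologicalSpace = t ∧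
    @CompleteSpace X m.toUniformSpace

/-- The model cube `I^n` for `n ≤ ω`: `some k` codes the finite cube `I^k`,
`none` codes the Hilbert cube `I^ω`. -/
def ModelCube : Option ℕ → Type
  | some k => Fin k → unitInterval
  | none => ℕ → unitInterval

instance : (n : Option ℕ) → TopologicalSpace (ModelCube n)
  | some k => inferInstanceAs (TopologicalSpace (Fin k → unitInterval))
  | none => inferInstanceAs (TopologicalSpace (ℕ → unitInterval))

/-- A manifold modeled on `E`: a paracompact space each point of which has an open
neighborhood homeomorphic to an open subset of `E`. -/
def IsManifoldModeledOn (M : Type*) [TopologicalSpace M] (E : Type*) [TopologicalSpace E] :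
    Prop :=
  ParacompactSpace M ∧
    ∀ x : M, ∃ O : Set M, IsOpen O ∧ x ∈ O ∧ ∃ U : Set E, IsOpen U ∧ Nonempty (↥O ≃ₜ ↥U)

/-- The pair `(X, A)` is homeomorphic to the pair `(Y, B)`. -/
def PairHomeo {X Y : Type*} [TopologicalSpace X] [TopologicalSpace Y]
    (A : Set X) (B : Set Y) : Prop :=
  ∃ e : X ≃ₜ Y, ⇑e '' A = B

/-- The cube `I^n` sitting inside `ℝ^n`. -/
def stdCube (n : ℕ) : Set (Fin n → ℝ) := {f | ∀ i, f i ∈ Icc (0 : ℝ) 1}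

/-- The copy of `I^ω × [0,1]` sitting inside `I^ω × [0,2)`. -/
def hilbertCollar : Set ((ℕ → unitInterval) × ↥(Ico (0 : ℝ) 2)) := {p | (p.2 : ℝ) ≤ 1}

/-- The Hilbert cube `I^ω`. -/
abbrev HilbertCube : Type := ℕ → unitInterval

/-- The space `I^ω × [0,1)`. -/
abbrev HilbertHalfOpen : Type := HilbertCube × ↥(Ico (0 : ℝ) 1)

/-- `B` is a tame ball in the `I^n`-manifold `M`: it has an open neighborhood `O` such
that the pair `(O, B)` is homeomorphic to `(ℝ^n, I^n)` (for finite `n`), resp. to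
`(I^ω × [0,2), I^ω × [0,1])` (for `n = ω`). -/
def IsTameBall (n : Option ℕ) {M : Type*} [TopologicalSpace M] (B : Set M) : Prop :=
  ∃ O : Set M, IsOpen O ∧ B ⊆ O ∧
    match n with
    | some k => PairHomeo {x : ↥O | (x : M) ∈ B} (stdCube k)
    | none => PairHomeo {x : ↥O | (x : M) ∈ B} hilbertCollar

/-- The family of all tame balls of the `I^n`-manifold `X`. -/
def tameBalls (n : Option ℕ) (X : Type*) [TopologicalSpace X] : Set (Set X) :=
  {B | IsTameBall n B}

/-- A family of subsets of `X` is vanishing if for any open cover `𝒰` of `X` the subfamily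
of sets contained in no member of `𝒰` is locally finite in `X`. -/
def VanishingFamily {X : Type*} [TopologicalSpace X] (F : Set (Set X)) : Prop :=
  ∀ 𝒰 : Set (Set X), (∀ u ∈ 𝒰, IsOpen u) → ⋃₀ 𝒰 = univ →
    LocallyFinite (fun A : {A : Set X // A ∈ F ∧ ∀ u ∈ 𝒰, ¬ A ⊆ u} => (A : Set X))

/-- The family of connected components of the complement of `S`. -/
def complComponents {X : Type*} [TopologicalSpace X] (S : Set X) : Set (Set X) :=
  {C | ∃ x ∈ Sᶜ, C = connectedComponentIn Sᶜ x}

/-- A spongy subset of an `I^n`-manifold. -/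
def IsSpongy (n : Option ℕ) {M : Type*} [TopologicalSpace M] (S : Set M) : Prop :=
  IsClosed S ∧ IsNowhereDense S ∧
  VanishingFamily (complComponents S) ∧
  (∀ C ∈ complComponents S, ∀ C' ∈ complComponents S, C ≠ C' →
    closure C ∩ closure C' = ∅) ∧
  ∀ C ∈ complComponents S, IsTameBall n (closure C)

/-- `S` is a universal nowhere dense subset of `M`. -/
def UniversalNowhereDense {M : Type*} [TopologicalSpace M] (S : Set M) : Prop :=
  IsNowhereDense S ∧ ∀ A : Set M, IsNowhereDense A → ∃ h : M ≃ₜ M, ⇑h '' A ⊆ S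

/-- `(f, g) ≺ 𝒜` : for each `z` with `f z ≠ g z` the doubleton `{f z, g z}` lies in some
member of `𝒜`. -/
def Near {Z X : Type*} (f g : Z → X) (𝒜 : Set (Set X)) : Prop :=
  ∀ z : Z, f z ≠ g z → ∃ A ∈ 𝒜, f z ∈ A ∧ g z ∈ A

/-- The star `St(A, 𝒰)` of a set `A` with respect to a family `𝒰`. -/
def covStar {X : Type*} (A : Set X) (𝒰 : Set (Set X)) : Set X :=
  ⋃₀ {u ∈ 𝒰 | (u ∩ A).Nonempty}

/-- A compact set `K ⊆ X` is locally shrinkable if for each open neighborhood `O` of `K`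
and each open cover `𝒱` of `O` there is a homeomorphism of `X` supported in `O` moving `K`
into a member of `𝒱`. -/
def LocallyShrinkable {X : Type*} [TopologicalSpace X] (K : Set X) : Prop :=
  ∀ O : Set X, IsOpen O → K ⊆ O →
    ∀ 𝒱 : Set (Set X), (∀ v ∈ 𝒱, IsOpen v ∧ v ⊆ O) → O ⊆ ⋃₀ 𝒱 →
      ∃ h : X ≃ₜ X, (∀ x ∉ O, h x = x) ∧ ∃ v ∈ 𝒱, ⇑h '' K ⊆ v

/-- A family of sets is ambiently invariant if it is invariant under images of
homeomorphisms of the ambient space. -/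
def AmbientlyInvariant {X : Type*} [TopologicalSpace X] (𝒦 : Set (Set X)) : Prop :=
  ∀ h : X ≃ₜ X, ∀ K ∈ 𝒦, ⇑h '' K ∈ 𝒦

/-- The local shift property of a family of sets. -/
def LocalShiftProperty {X : Type*} [TopologicalSpace X] (𝒦 : Set (Set X)) : Prop :=
  ∀ x : X, ∀ O ∈ 𝓝 x, ∃ U ∈ 𝓝 x, U ⊆ O ∧
    ∀ A ∈ 𝒦, ∀ B ∈ 𝒦, A ⊆ U → B ⊆ U →
      ∃ h : X ≃ₜ X, ⇑h '' A = B ∧ ∀ y ∉ O, h y = y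

/-- A tame family of compact subsets of `X`. -/
def IsTameFamily {X : Type*} [TopologicalSpace X] (𝒦 : Set (Set X)) : Prop :=
  (∀ K ∈ 𝒦, IsCompact K) ∧ AmbientlyInvariant 𝒦 ∧ (∀ K ∈ 𝒦, LocallyShrinkable K) ∧
    LocalShiftProperty 𝒦 ∧ ∀ U : Set X, IsOpen U → U.Nonempty → ∃ K ∈ 𝒦, K ⊆ U

/-- `X` is strongly locally homogeneous. -/
def StronglyLocallyHomogeneous (X : Type*) [TopologicalSpace X] : Prop :=
  ∀ x : X, ∀ O ∈ 𝓝 x, ∃ U ∈ 𝓝 x, U ⊆ O ∧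
    ∀ y ∈ U, ∃ h : X ≃ₜ X, h x = y ∧ ∀ z ∉ O, h z = z

/-- `X` is topologically homogeneous. -/
def TopologicallyHomogeneous (X : Type*) [TopologicalSpace X] : Prop :=
  ∀ x y : X, ∃ h : X ≃ₜ X, h x = y

/-- `A` is σ-discrete in `X`: a countable union of closed discrete subsets of `X`. -/
def SigmaDiscrete {X : Type*} [TopologicalSpace X] (A : Set X) : Prop :=
  ∃ f : ℕ → Set X, A = ⋃ n, f n ∧ ∀ n, IsClosed (f n) ∧ DiscreteTopology ↥(f n)

/-! ### Decompositions -/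

/-- A decomposition of a topological space `X`: a cover of `X` by pairwise disjoint
nonempty compact subsets. -/
structure Decomposition (X : Type*) [TopologicalSpace X] where
  pieces : Set (Set X)
  nonempty' : ∀ A ∈ pieces, A.Nonempty
  isCompact' : ∀ A ∈ pieces, IsCompact A
  disjoint' : ∀ A ∈ pieces, ∀ B ∈ pieces, A ≠ B → Disjoint A B
  covers : ∀ x : X, ∃ A ∈ pieces, x ∈ A

namespace Decomposition

variable {X : Type*} [TopologicalSpace X] (D : Decomposition X)

/-- The decomposition space `X/D` (as a set it is the set of pieces). -/
def Space : Type _ := {A : Set X // A ∈ D.pieces}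

/-- The quotient map `q_D : X → X/D`. -/
noncomputable def q (x : X) : D.Space := ⟨(D.covers x).choose, (D.covers x).choose_spec.1⟩

/-- The quotient topology on the decomposition space. -/
instance : TopologicalSpace D.Space := TopologicalSpace.coinduced D.q inferInstance

/-- The non-degeneracy part `D°` of a decomposition, viewed inside the decomposition
space. -/
def nondeg : Set D.Space := {A | ¬ (A.1 : Set X).Subsingleton}

/-- The union of the non-degenerate pieces of a decomposition. -/
def nondegUnion : Set X := ⋃₀ {A ∈ D.pieces | ¬ A.Subsingleton}

/-- A `D`-saturated subset of `X`. -/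
def Saturated (U : Set X) : Prop := ∀ A ∈ D.pieces, (A ∩ U).Nonempty → A ⊆ U

/-- A decomposition is upper semicontinuous if saturations of closed sets are closed. -/
def IsUSC : Prop :=
  ∀ F : Set X, IsClosed F → IsClosed (⋃₀ {A ∈ D.pieces | (A ∩ F).Nonempty})

/-- A decomposition is vanishing if for every open cover `𝒰` of `X` the family of pieces
contained in no member of `𝒰` is discrete in `X`. -/
def Vanishing : Prop :=
  ∀ 𝒰 : Set (Set X), (∀ u ∈ 𝒰, IsOpen u) → ⋃₀ 𝒰 = univ →
    ∀ x : X, ∃ V ∈ 𝓝 x, ∀ A ∈ D.pieces, (∀ u ∈ 𝒰, ¬ A ⊆ u) →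
      ∀ B ∈ D.pieces, (∀ u ∈ 𝒰, ¬ B ⊆ u) →
        (V ∩ A).Nonempty → (V ∩ B).Nonempty → A = B

/-- The restriction of `D` to a (`D`-saturated open) set `U` is shrinkable: for each
`D`-saturated open cover `𝒰` of `U` and each open cover `𝒱` of `U` there is a
homeomorphism `h` of the subspace `U` with `(h, id) ≺ 𝒰` and `{h(A) : A ∈ D, A ⊆ U} ≺ 𝒱`. -/
def ShrinkableOn (U : Set X) : Prop :=
  ∀ 𝒰 : Set (Set X),
    (∀ u ∈ 𝒰, IsOpen u ∧ u ⊆ U ∧ ∀ A ∈ D.pieces, A ⊆ U → (A ∩ u).Nonempty → A ⊆ u) →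
    U ⊆ ⋃₀ 𝒰 →
    ∀ 𝒱 : Set (Set X), (∀ v ∈ 𝒱, IsOpen v ∧ v ⊆ U) → U ⊆ ⋃₀ 𝒱 →
      ∃ h : ↥U ≃ₜ ↥U,
        Near (fun x : ↥U => (h x : X)) (fun x : ↥U => (x : X)) 𝒰 ∧
        ∀ A ∈ D.pieces, A ⊆ U →
          ∃ v ∈ 𝒱, (fun x : ↥U => (x : X)) '' (⇑h '' {x : ↥U | (x : X) ∈ A}) ⊆ v

/-- A decomposition is strongly shrinkable if its restriction to any `D`-saturated open
set is shrinkable. -/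
def StronglyShrinkable : Prop :=
  ∀ U : Set X, IsOpen U → D.Saturated U → D.ShrinkableOn U

/-- A decomposition is `𝒦`-tame if it is vanishing, strongly shrinkable, and all its
non-degenerate pieces belong to `𝒦`. -/
def KTame (𝒦 : Set (Set X)) : Prop :=
  D.Vanishing ∧ D.StronglyShrinkable ∧ ∀ A ∈ D.pieces, ¬ A.Subsingleton → A ∈ 𝒦

/-- A decomposition is dense if its non-degeneracy part is dense in the decomposition
space. -/
def IsDenseDecomp : Prop := Dense D.nondeg

/-- A decomposition is discrete if its non-degeneracy part is closed and discrete in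
the decomposition space. -/
def IsDiscreteDecomp : Prop := IsClosed D.nondeg ∧ DiscreteTopology ↥D.nondeg

end Decomposition

/-- A homeomorphism `φ : X/A → X/B` is `(A,B)`-liftable if it lifts to a homeomorphism
`Φ : X → X` with `q_B ∘ Φ = φ ∘ q_A`. -/
def Liftable {X : Type*} [TopologicalSpace X] (A B : Decomposition X)
    (φ : A.Space ≃ₜ B.Space) : Prop :=
  ∃ Φ : X ≃ₜ X, ∀ x : X, B.q (Φ x) = φ (A.q x)

/-- Two decompositions of `X` are topologically equivalent if some homeomorphism of `X`
maps the first family of pieces onto the second. -/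
def TopEquivDecomp {X : Type*} [TopologicalSpace X] (A B : Decomposition X) : Prop :=
  ∃ Φ : X ≃ₜ X, (fun S : Set X => ⇑Φ '' S) '' A.pieces = B.pieces

/-- A `𝒦`-spongy subset of `X`. -/
def IsKSpongy {X : Type*} [TopologicalSpace X] (𝒦 : Set (Set X)) (S : Set X) : Prop :=
  ∃ D : Decomposition X, D.KTame 𝒦 ∧ D.IsDenseDecomp ∧
    Sᶜ = ⋃ A ∈ D.pieces, interior A

/-! ### Shape notions -/

/-- `K` is point-like in `X`. -/
def PointLike {X : Type*} [TopologicalSpace X] (K : Set X) : Prop :=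
  ∀ N : Set X, IsClosed N → K ⊆ interior N →
    ∃ x ∈ interior N, Nonempty (↥(N \ K) ≃ₜ ↥(N \ {x}))

/-- `K` is contractible in `U`: the inclusion `K ↪ U` is homotopic to a constant map. -/
def ContractibleIn {X : Type*} [TopologicalSpace X] (K U : Set X) : Prop :=
  ∃ hKU : K ⊆ U, ∃ y : ↥U,
    (ContinuousMap.mk (Set.inclusion hKU) (continuous_inclusion hKU)).Homotopic
      (ContinuousMap.const ↥K y)

/-- `K` is cell-like in `X`: `K` is contractible in each of its neighborhoods. -/
def CellLike {X : Type*} [TopologicalSpace X] (K : Set X) : Prop :=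
  ∀ U : Set X, IsOpen U → K ⊆ U → ContractibleIn K U

/-- `K` is cellular (with model `E`): every neighborhood of `K` contains a neighborhood
of `K` homeomorphic to `E`. -/
def CellularIn (E : Type*) [TopologicalSpace E] {X : Type*} [TopologicalSpace X]
    (K : Set X) : Prop :=
  ∀ U : Set X, IsOpen U → K ⊆ U → ∃ V ∈ 𝓝ˢ K, V ⊆ U ∧ Nonempty (↥V ≃ₜ E)

/-- `X` is locally contractible. -/
def LocallyContractible (X : Type*) [TopologicalSpace X] : Prop :=
  ∀ x : X, ∀ U ∈ 𝓝 x, ∃ V ∈ 𝓝 x, V ⊆ U ∧ ContractibleIn V U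

/-! ### Continuous pseudometrics -/

/-- A continuous pseudometric, given as a real valued function of two variables. -/
structure IsContPseudometric {X : Type*} [TopologicalSpace X] (ρ : X → X → ℝ) : Prop where
  refl : ∀ x, ρ x x = 0
  symm : ∀ x y, ρ x y = ρ y x
  tri : ∀ x y z, ρ x z ≤ ρ x y + ρ y z
  cont : Continuous fun p : X × X => ρ p.1 p.2

namespace IsContPseudometric

variable {X Y : Type*} [TopologicalSpace X] [TopologicalSpace Y] {ρ τ : X → X → ℝ}

lemma nonneg (h : IsContPseudometric ρ) (x y : X) : 0 ≤ ρ x y := by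
  have h1 := h.tri x y x
  rw [h.refl, h.symm y x] at h1
  linarith

lemma add (h : IsContPseudometric ρ) (h' : IsContPseudometric τ) :
    IsContPseudometric fun x y => ρ x y + τ x y where
  refl x := by rw [h.refl, h'.refl, add_zero]
  symm x y := by rw [h.symm, h'.symm]
  tri x y z := by linarith [h.tri x y z, h'.tri x y z]
  cont := h.cont.add h'.cont

lemma comp (h : IsContPseudometric ρ) {f : Y → X} (hf : Continuous f) :
    IsContPseudometric fun x y => ρ (f x) (f y) where
  refl _ := h.refl _
  symm _ _ := h.symm _ _
  tri _ _ _ := h.tri _ _ _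
  cont := h.cont.comp ((hf.comp continuous_fst).prodMk (hf.comp continuous_snd))

lemma continuous_right (h : IsContPseudometric ρ) (x : X) : Continuous fun y => ρ x y :=
  h.cont.comp (continuous_const.prodMk continuous_id)

lemma isOpen_ball (h : IsContPseudometric ρ) (x : X) (r : ℝ) : IsOpen {y | ρ x y < r} :=
  isOpen_lt (h.continuous_right x) continuous_const

/-- A compact set of small diameter has a neighborhood of small diameter. -/
lemma exists_isOpen_of_isCompact (h : IsContPseudometric ρ) {K : Set X} (hK : IsCompact K) {ε : ℝ}
    (hε : ∀ x ∈ K, ∀ y ∈ K, ρ x y < ε) :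
    ∃ O, IsOpen O ∧ K ⊆ O ∧ ∀ x ∈ O, ∀ y ∈ O, ρ x y < ε := by
  obtain ⟨u, v, hu, hv, hKu, hKv, huv⟩ := generalized_tube_lemma hK hK
    (isOpen_lt h.cont continuous_const : IsOpen {p : X × X | ρ p.1 p.2 < ε})
    (fun p hp => hε _ hp.1 _ hp.2)
  exact ⟨u ∩ v, hu.inter hv, subset_inter hKu hKv,
    fun x hx y hy => huv (mk_mem_prod hx.1 hy.2)⟩

lemma exists_isOpen_of_pos (h : IsContPseudometric ρ) (x : X) {ε : ℝ} (hε : 0 < ε) :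
    ∃ O, IsOpen O ∧ x ∈ O ∧ ∀ y ∈ O, ∀ z ∈ O, ρ y z < ε := by
  obtain ⟨O, hO, hxO, h'⟩ := h.exists_isOpen_of_isCompact (isCompact_singleton (x := x)) (ε := ε)
    (by rintro _ rfl _ rfl; rwa [h.refl])
  exact ⟨O, hO, hxO rfl, h'⟩

end IsContPseudometric

lemma isContPseudometric_dist (X : Type*) [MetricSpace X] :
    IsContPseudometric (fun x y : X => dist x y) :=
  ⟨dist_self, dist_comm, dist_triangle, continuous_dist⟩

/-! ### Classes of a decomposition -/

namespace Decomposition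

section Classes

variable {X : Type*} [TopologicalSpace X] (D : Decomposition X)

/-- The piece of the decomposition containing a given point. -/
def cls (x : X) : Set X := (D.q x).1

lemma cls_mem (x : X) : D.cls x ∈ D.pieces := (D.q x).2

lemma mem_cls (x : X) : x ∈ D.cls x := (D.covers x).choose_spec.2

variable {D} in
lemma eq_of_mem_of_mem {K L : Set X} (hK : K ∈ D.pieces) (hL : L ∈ D.pieces) {x : X} (hx : x ∈ K)
    (hx' : x ∈ L) : K = L := by
  by_contra h
  exact disjoint_left.1 (D.disjoint' K hK L hL h) hx hx'

variable {D} in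
lemma cls_eq {K : Set X} (hK : K ∈ D.pieces) {x : X} (hx : x ∈ K) : D.cls x = K :=
  eq_of_mem_of_mem (D.cls_mem x) hK (D.mem_cls x) hx

lemma q_eq_iff {x y : X} : D.q x = D.q y ↔ D.cls x = D.cls y := Subtype.ext_iff

lemma q_surjective : Function.Surjective D.q := by
  rintro ⟨K, hK⟩
  obtain ⟨x, hx⟩ := D.nonempty' K hK
  exact ⟨x, Subtype.ext (cls_eq hK hx)⟩

lemma isQuotientMap_q : IsQuotientMap D.q := ⟨⟨rfl⟩, D.q_surjective⟩

lemma continuous_q : Continuous D.q := D.isQuotientMap_q.continuous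

/-- Pieces that are large with respect to a continuous pseudometric form a discrete family. -/
lemma Vanishing.locally_unique {D : Decomposition X} (hD : D.Vanishing) {ρ : X → X → ℝ}
    (hρ : IsContPseudometric ρ) {ε : ℝ} (hε : 0 < ε) (x : X) :
    ∃ V, IsOpen V ∧ x ∈ V ∧ ∀ K ∈ D.pieces, (¬ ∀ y ∈ K, ∀ z ∈ K, ρ y z < ε) →
      ∀ L ∈ D.pieces, (¬ ∀ y ∈ L, ∀ z ∈ L, ρ y z < ε) →
      (V ∩ K).Nonempty → (V ∩ L).Nonempty → K = L := by
  obtain ⟨V, hV, h⟩ := hD {O | IsOpen O ∧ ∀ y ∈ O, ∀ z ∈ O, ρ y z < ε} (fun u hu => hu.1)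
    (eq_univ_of_forall fun y => by
      obtain ⟨O, hO, hy, h⟩ := hρ.exists_isOpen_of_pos y hε
      exact ⟨O, ⟨hO, h⟩, hy⟩) x
  obtain ⟨V', hV', hV'o, hx⟩ := mem_nhds_iff.1 hV
  refine ⟨V', hV'o, hx, fun K hK hK' L hL hL' h1 h2 => h K hK ?_ L hL ?_
    (h1.mono (inter_subset_inter_left _ hV')) (h2.mono (inter_subset_inter_left _ hV'))⟩
  · exact fun u hu hKu => hK' fun y hy z hz => hu.2 y (hKu hy) z (hKu hz)
  · exact fun u hu hKu => hL' fun y hy z hz => hu.2 y (hKu hy) z (hKu hz)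

end Classes

section Metric

variable {X : Type*} [MetricSpace X] {D : Decomposition X}

/-- A piece meeting a small ball around `x` contains `x` or is small. -/
lemma Vanishing.mem_or_small (hD : D.Vanishing) (x : X) {ε : ℝ} (hε : 0 < ε) :
    ∃ δ > 0, ∀ K ∈ D.pieces, ∀ k ∈ K, dist k x < δ →
      x ∈ K ∨ ∀ y ∈ K, ∀ z ∈ K, dist y z < ε := by
  obtain ⟨V, hVo, hxV, hV⟩ := hD.locally_unique (isContPseudometric_dist X) hε x
  by_cases hb : ∃ K ∈ D.pieces, (¬ ∀ y ∈ K, ∀ z ∈ K, dist y z < ε) ∧ (V ∩ K).Nonempty ∧ x ∉ K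
  · obtain ⟨K, hK, hKb, hKV, hxK⟩ := hb
    obtain ⟨δ, hδ, hδV⟩ := Metric.isOpen_iff.1
      (hVo.inter (D.isCompact' K hK).isClosed.isOpen_compl) x ⟨hxV, hxK⟩
    refine ⟨δ, hδ, fun L hL k hk hkx => ?_⟩
    by_contra! hcon
    have hLb : ¬ ∀ y ∈ L, ∀ z ∈ L, dist y z < ε := by push Not; exact hcon.2
    have := hV K hK hKb L hL hLb hKV ⟨k, (hδV hkx).1, hk⟩
    exact (hδV hkx).2 (this ▸ hk)
  · push Not at hb
    obtain ⟨δ, hδ, hδV⟩ := Metric.isOpen_iff.1 hVo x hxV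
    refine ⟨δ, hδ, fun L hL k hk hkx => ?_⟩
    by_contra! hcon
    exact hcon.1 (hb L hL hcon.2 ⟨k, hδV hkx, hk⟩)

lemma Vanishing.isOpen_core (hD : D.Vanishing) {O : Set X} (hO : IsOpen O) :
    IsOpen {x | D.cls x ⊆ O} := by
  refine Metric.isOpen_iff.2 fun x hx => ?_
  obtain ⟨ε, hε, hεO⟩ := Metric.isOpen_iff.1 hO x (hx (D.mem_cls x))
  obtain ⟨δ, hδ, h⟩ := hD.mem_or_small x (half_pos hε)
  refine ⟨min δ (ε / 2), lt_min hδ (half_pos hε), fun y hy => ?_⟩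
  have hy' : dist y x < min δ (ε / 2) := hy
  rcases h _ (D.cls_mem y) y (D.mem_cls y) (hy'.trans_le (min_le_left _ _)) with h1 | h1
  · have : D.cls y = D.cls x := (cls_eq (D.cls_mem y) h1).symm
    change D.cls y ⊆ O
    rw [this]; exact hx
  · intro z hz
    apply hεO
    have := h1 z hz y (D.mem_cls y)
    have h2 := hy'.trans_le (min_le_right _ _)
    have h3 := dist_triangle z y x
    rw [Metric.mem_ball]
    linarith

end Metric

end Decomposition

/-! ### Extending homeomorphisms of open subsets -/

lemma continuous_extension {X : Type*} [MetricSpace X] {U : Set X} (hU : IsOpen U) {e : ↥U → ↥U}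
    (he : Continuous e)
    (h1 : ∀ x ∉ U, ∀ ε > 0, ∃ δ > 0, ∀ y : ↥U, dist (y : X) x < δ → dist (e y : X) y < ε)
    {f : X → X} (hf : ∀ x : ↥U, f x = e x) (hf' : ∀ x ∉ U, f x = x) : Continuous f := by
  rw [continuous_iff_continuousAt]
  intro x
  by_cases hx : x ∈ U
  · have : ContinuousOn f U := by
      rw [continuousOn_iff_continuous_domRestrict]
      have : U.domRestrict f = fun x => (e x : X) := funext hf
      rw [this]
      exact continuous_subtype_val.comp he
    exact this.continuousAt (hU.mem_nhds hx)
  · rw [Metric.continuousAt_iff]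
    intro ε hε
    obtain ⟨δ, hδ, h⟩ := h1 x hx (ε / 2) (half_pos hε)
    refine ⟨min δ (ε / 2), lt_min hδ (half_pos hε), fun {y} hy => ?_⟩
    rw [hf' x hx]
    by_cases hyU : y ∈ U
    · have h2 := h ⟨y, hyU⟩ (hy.trans_le (min_le_left _ _))
      have h3 := hf ⟨y, hyU⟩
      simp only at h2 h3
      rw [h3]
      have := dist_triangle (e ⟨y, hyU⟩ : X) y x
      linarith [hy.trans_le (min_le_right _ _)]
    · rw [hf' y hyU]
      linarith [hy.trans_le (min_le_right _ _)]

lemma exists_homeomorph_extension {X : Type*} [MetricSpace X] {U : Set X} (hU : IsOpen U)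
    (e : ↥U ≃ₜ ↥U)
    (h1 : ∀ x ∉ U, ∀ ε > 0, ∃ δ > 0, ∀ y : ↥U, dist (y : X) x < δ → dist (e y : X) y < ε)
    (h2 : ∀ x ∉ U, ∀ ε > 0, ∃ δ > 0, ∀ y : ↥U, dist (y : X) x < δ → dist (e.symm y : X) y < ε) :
    ∃ h : X ≃ₜ X, (∀ x ∉ U, h x = x) ∧ ∀ x : ↥U, h x = e x := by
  classical
  let f : X → X := fun x => if hx : x ∈ U then e ⟨x, hx⟩ else x
  let g : X → X := fun x => if hx : x ∈ U then e.symm ⟨x, hx⟩ else x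
  have hf : ∀ x : ↥U, f x = e x := fun x => by simp [f]
  have hg : ∀ x : ↥U, g x = e.symm x := fun x => by simp [g]
  have hf' : ∀ x ∉ U, f x = x := fun x hx => by simp [f, hx]
  have hg' : ∀ x ∉ U, g x = x := fun x hx => by simp [g, hx]
  refine ⟨⟨⟨f, g, fun x => ?_, fun x => ?_⟩, continuous_extension hU e.continuous h1 hf hf',
    continuous_extension hU e.symm.continuous h2 hg hg'⟩, hf', hf⟩
  · by_cases hx : x ∈ U
    · have := hf ⟨x, hx⟩
      simp only at this
      rw [this, hg, e.symm_apply_apply]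
    · rw [hf' x hx, hg' x hx]
  · by_cases hx : x ∈ U
    · have := hg ⟨x, hx⟩
      simp only at this
      rw [this, hf, e.apply_symm_apply]
    · rw [hg' x hx, hf' x hx]

namespace Decomposition

/-- Pieces contained in the saturated open set `U` can be shrunk by a homeomorphism of the whole
space which is the identity off `U`, moves points of `U` inside sets that are as close to the pieces
as we want (as prescribed by `E`) and maps pieces to sets that are as small as we want
(as prescribed by `F`). -/
def ShrinksIn {X : Type*} [TopologicalSpace X] (D : Decomposition X) (U : Set X) : Prop :=
  ∀ E F : X → X → Prop,
    (∀ K ∈ D.pieces, K ⊆ U → ∃ O, IsOpen O ∧ K ⊆ O ∧ ∀ x ∈ O, ∀ y ∈ O, E x y) →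
    (∀ x ∈ U, ∃ O, IsOpen O ∧ x ∈ O ∧ ∀ y ∈ O, ∀ z ∈ O, F y z) →
    ∃ h : X ≃ₜ X, (∀ x ∉ U, h x = x) ∧ (∀ x ∈ U, E (h x) x) ∧
      ∀ K ∈ D.pieces, K ⊆ U → ∀ x ∈ K, ∀ y ∈ K, F (h x) (h y)

lemma ShrinkableOn.shrinksIn {X : Type*} [MetricSpace X] {D : Decomposition X}
    (hD : D.Vanishing) {U : Set X} (hU : IsOpen U) (hsat : D.Saturated U)
    (hs : D.ShrinkableOn U) : D.ShrinksIn U := by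
  intro E F hE hF
  have hcov : ∀ x ∈ U, ∃ S : Set X, x ∈ S ∧ (IsOpen S ∧ S ⊆ U ∧
      ∀ A ∈ D.pieces, A ⊆ U → (A ∩ S).Nonempty → A ⊆ S) ∧ (∀ x ∈ S, ∀ y ∈ S, E x y) ∧
      ∃ K ∈ D.pieces, K ⊆ U ∧ ∃ r > 0, (∀ x ∈ S, ∃ k ∈ K, dist x k < r) ∧
        ∀ z ∉ U, ∀ k ∈ K, 2 * r ≤ dist k z := by
    intro x hx
    have hKU : D.cls x ⊆ U := hsat _ (D.cls_mem x) ⟨x, D.mem_cls x, hx⟩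
    obtain ⟨O, hO, hKO, hOE⟩ := hE _ (D.cls_mem x) hKU
    obtain ⟨δ, hδ, hδU⟩ := (D.isCompact' _ (D.cls_mem x)).exists_thickening_subset_open hU hKU
    refine ⟨{y | D.cls y ⊆ Metric.thickening (δ / 2) (D.cls x) ∩ O}, ?_, ⟨?_, ?_, ?_⟩, ?_,
      D.cls x, D.cls_mem x, hKU, δ / 2, half_pos hδ, ?_, ?_⟩
    · exact subset_inter (Metric.self_subset_thickening (half_pos hδ) _) hKO
    · exact hD.isOpen_core (Metric.isOpen_thickening.inter hO)
    · exact fun y hy => hδU (Metric.thickening_mono (half_le_self hδ.le) _ (hy (D.mem_cls y)).1)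
    · rintro A hA - ⟨a, haA, ha⟩ b hb
      rw [mem_ofPred_eq, cls_eq hA haA] at ha
      rwa [mem_ofPred_eq, cls_eq hA hb]
    · exact fun y hy z hz => hOE y (hy (D.mem_cls y)).2 z (hz (D.mem_cls z)).2
    · exact fun y hy => Metric.mem_thickening_iff.1 (hy (D.mem_cls y)).1
    · intro z hz k hk
      by_contra! hlt
      exact hz (hδU (Metric.mem_thickening_iff.2 ⟨k, hk, by rw [dist_comm]; linarith⟩))
  obtain ⟨e, he, he'⟩ := hs
    {S : Set X | (IsOpen S ∧ S ⊆ U ∧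
      ∀ A ∈ D.pieces, A ⊆ U → (A ∩ S).Nonempty → A ⊆ S) ∧ (∀ x ∈ S, ∀ y ∈ S, E x y) ∧
      ∃ K ∈ D.pieces, K ⊆ U ∧ ∃ r > 0, (∀ x ∈ S, ∃ k ∈ K, dist x k < r) ∧
        ∀ z ∉ U, ∀ k ∈ K, 2 * r ≤ dist k z} (fun u hu => hu.1)
    (fun x hx => by obtain ⟨S, hxS, hS⟩ := hcov x hx; exact ⟨S, hS, hxS⟩)
    {v : Set X | (IsOpen v ∧ v ⊆ U) ∧ ∀ x ∈ v, ∀ y ∈ v, F x y} (fun v hv => hv.1)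
    (fun x hx => by
      obtain ⟨O, hO, hxO, hOF⟩ := hF x hx
      exact ⟨O ∩ U, ⟨⟨hO.inter hU, inter_subset_right⟩,
        fun y hy z hz => hOF y hy.1 z hz.1⟩, hxO, hx⟩)
  have hnear : ∀ x : ↥U, ∃ S : Set X, (x : X) ∈ S ∧ (e x : X) ∈ S ∧ (∀ x ∈ S, ∀ y ∈ S, E x y) ∧
      ∃ K ∈ D.pieces, K ⊆ U ∧ ∃ r > 0, (∀ x ∈ S, ∃ k ∈ K, dist x k < r) ∧
        ∀ z ∉ U, ∀ k ∈ K, 2 * r ≤ dist k z := by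
    intro x
    by_cases hx : (e x : X) = x
    · obtain ⟨S, hxS, hS⟩ := hcov x x.2
      exact ⟨S, hxS, by rwa [hx], hS.2⟩
    · obtain ⟨S, hS, h1, h2⟩ := he x hx
      exact ⟨S, h2, h1, hS.2⟩
  have hest : ∀ x ∉ U, ∀ ε > 0, ∃ δ > 0, ∀ (K : Set X), K ∈ D.pieces → K ⊆ U → ∀ r > 0,
      (∀ z ∉ U, ∀ k ∈ K, 2 * r ≤ dist k z) → ∀ y y' : X, (∃ k ∈ K, dist y k < r) →
      (∃ k ∈ K, dist y' k < r) → dist y x < δ → dist y y' < ε := by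
    intro x hx ε hε
    obtain ⟨δ, hδ, h⟩ := hD.mem_or_small x (ε := ε / 2) (by positivity)
    refine ⟨min (δ / 4) (ε / 4), by positivity, ?_⟩
    rintro K hK hKU r hr hrK y y' ⟨k, hk, hyk⟩ ⟨k', hk', hyk'⟩ hyx
    have ha := hyx.trans_le (min_le_left _ _)
    have hb := hyx.trans_le (min_le_right _ _)
    have h1 := hrK x hx k hk
    have h2 := dist_triangle k y x
    rw [dist_comm k y] at h2
    have h5 : dist k k' < ε / 2 := by
      rcases h K hK k hk (by linarith) with h' | h'
      · exact absurd (hKU h') hx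
      · exact h' _ hk _ hk'
    have h3 := dist_triangle y k y'
    have h4 := dist_triangle k k' y'
    rw [dist_comm k' y'] at h4
    linarith
  obtain ⟨h, hid, hh⟩ := exists_homeomorph_extension hU e
    (by
      intro x hx ε hε
      obtain ⟨δ, hδ, H⟩ := hest x hx ε hε
      refine ⟨δ, hδ, fun y hy => ?_⟩
      obtain ⟨S, hyS, heS, -, K, hK, hKU, r, hr, hSK, hrK⟩ := hnear y
      rw [dist_comm]
      exact H K hK hKU r hr hrK _ _ (hSK _ hyS) (hSK _ heS) hy)
    (by
      intro x hx ε hε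
      obtain ⟨δ, hδ, H⟩ := hest x hx ε hε
      refine ⟨δ, hδ, fun y hy => ?_⟩
      obtain ⟨S, hyS, heS, -, K, hK, hKU, r, hr, hSK, hrK⟩ := hnear (e.symm y)
      rw [e.apply_symm_apply] at heS
      rw [dist_comm]
      exact H K hK hKU r hr hrK _ _ (hSK _ heS) (hSK _ hyS) hy)
  refine ⟨h, hid, fun x hx => ?_, fun K hK hKU x hx y hy => ?_⟩
  · obtain ⟨S, hyS, heS, hS, -⟩ := hnear ⟨x, hx⟩
    have := hh ⟨x, hx⟩
    simp only at this
    rw [this]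
    exact hS _ heS _ hyS
  · obtain ⟨v, hv, hvK⟩ := he' K hK hKU
    have h1 := hh ⟨x, hKU hx⟩
    have h2 := hh ⟨y, hKU hy⟩
    simp only at h1 h2
    rw [h1, h2]
    exact hv.2 _ (hvK ⟨_, ⟨⟨x, hKU hx⟩, hx, rfl⟩, rfl⟩) _ (hvK ⟨_, ⟨⟨y, hKU hy⟩, hy, rfl⟩, rfl⟩)

end Decomposition

/-! ### Pseudometrics defining the topology of a decomposition space -/

lemma exists_pseudometric_of_entourages {Y : Type*} (V : ℕ → Y → Y → Prop)
    (hrefl : ∀ n x, V n x x) (hsymm : ∀ n x y, V n x y → V n y x)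
    (hcomp : ∀ n x y z, V (n + 1) x y → V (n + 1) y z → V n x z) :
    ∃ ρ : Y → Y → ℝ, (∀ x, ρ x x = 0) ∧ (∀ x y, ρ x y = ρ y x) ∧
      (∀ x y z, ρ x z ≤ ρ x y + ρ y z) ∧ (∀ n, ∃ r > 0, ∀ x y, ρ x y < r → V n x y) ∧
      ∀ r > 0, ∃ n, ∀ x y, V n x y → ρ x y < r := by
  have hanti : ∀ m n x y, m ≤ n → V n x y → V m x y := by
    intro m n x y hmn
    induction n, hmn using Nat.le_induction with
    | base => exact id
    | succ n _ ih => exact fun h => ih (hcomp n x y y h (hrefl _ _))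
  let 𝓕 : Filter (Y × Y) :=
    { sets := {R | ∃ n, ∀ x y, V n x y → (x, y) ∈ R}
      univ_sets := ⟨0, fun _ _ _ => trivial⟩
      sets_of_superset := fun ⟨n, hn⟩ h => ⟨n, fun x y hxy => h (hn x y hxy)⟩
      inter_sets := fun ⟨n, hn⟩ ⟨m, hm⟩ => ⟨max n m, fun x y hxy =>
        ⟨hn x y (hanti _ _ _ _ (le_max_left _ _) hxy),
          hm x y (hanti _ _ _ _ (le_max_right _ _) hxy)⟩⟩ }
  have hmem : ∀ R, R ∈ 𝓕 ↔ ∃ n, ∀ x y, V n x y → (x, y) ∈ R := fun R => Iff.rfl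
  let c : UniformSpace.Core Y := UniformSpace.Core.mk' 𝓕
    (fun r ⟨n, hn⟩ x => hn x x (hrefl n x))
    (fun r ⟨n, hn⟩ => ⟨n, fun x y hxy => hn y x (hsymm n x y hxy)⟩)
    (fun r ⟨n, hn⟩ => ⟨{p | V (n + 1) p.1 p.2}, ⟨n + 1, fun x y h => h⟩, by
      rintro ⟨x, z⟩ ⟨y, h1, h2⟩
      exact hn x z (hcomp n x y z h1 h2)⟩)
  let u : UniformSpace Y := UniformSpace.ofCore c
  have hu : uniformity Y = 𝓕 := rfl
  have hbasis : (uniformity Y).HasBasis (fun _ : ℕ => True) fun n => {p | V n p.1 p.2} :=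
    ⟨fun t => by
      rw [hu, hmem]
      simp only [true_and]
      exact ⟨fun ⟨n, hn⟩ => ⟨n, fun p hp => hn p.1 p.2 hp⟩, fun ⟨n, hn⟩ => ⟨n, fun x y h => hn h⟩⟩⟩
  have : (uniformity Y).IsCountablyGenerated :=
    Filter.HasCountableBasis.isCountablyGenerated ⟨hbasis, Set.to_countable _⟩
  obtain ⟨J, hJ⟩ := UniformSpace.metrizable_uniformity Y
  have hJu : @uniformity Y J.toUniformSpace = 𝓕 := by rw [hJ, hu]
  refine ⟨fun x y => J.dist x y, J.dist_self, J.dist_comm, J.dist_triangle, fun n => ?_,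
    fun r hr => ?_⟩
  · have h1 : {p : Y × Y | V n p.1 p.2} ∈ @uniformity Y J.toUniformSpace := by
      rw [hJu, hmem]; exact ⟨n, fun _ _ h => h⟩
    obtain ⟨r, hr, h⟩ := (@Metric.mem_uniformity_dist Y J _).1 h1
    exact ⟨r, hr, fun x y hxy => h hxy⟩
  · have h1 : {p : Y × Y | J.dist p.1 p.2 < r} ∈ @uniformity Y J.toUniformSpace :=
      (@Metric.mem_uniformity_dist Y J _).2 ⟨r, hr, fun x y h => h⟩
    rw [hJu, hmem] at h1
    exact h1

namespace Decomposition

section Metrization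

variable {X : Type*} [MetricSpace X] {D : Decomposition X}

variable (D) in
/-- Covers by saturated open sets. -/
def IsSatCover (𝒮 : Set (Set X)) : Prop :=
  (∀ S ∈ 𝒮, IsOpen S ∧ ∀ x ∈ S, D.cls x ⊆ S) ∧ ∀ x, ∃ S ∈ 𝒮, x ∈ S

lemma Vanishing.exists_barycentric_refinement (hD : D.Vanishing) {𝒮 : Set (Set X)}
    (h𝒮 : D.IsSatCover 𝒮) :
    ∃ 𝒲, D.IsSatCover 𝒲 ∧ ∀ y, ∃ S ∈ 𝒮, ∀ W ∈ 𝒲, y ∈ W → W ⊆ S := by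
  obtain ⟨v, hvo, hvU, hvf, hvs⟩ := precise_refinement (fun i : 𝒮 => (i : Set X))
    (fun i => (h𝒮.1 i i.2).1) (by
      refine eq_univ_of_forall fun x => ?_
      obtain ⟨S, hS, hx⟩ := h𝒮.2 x
      exact mem_iUnion.2 ⟨⟨S, hS⟩, hx⟩)
  obtain ⟨w, hwU, -, hwv⟩ := exists_iUnion_eq_closure_subset hvo (fun x => hvf.point_finite x) hvU
  have hFf : LocallyFinite fun i => closure (w i) := hvf.subset hwv
  have hws : ∀ i : 𝒮, closure (w i) ⊆ (i : Set X) := fun i => (hwv i).trans (hvs i)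
  let W : X → Set X := fun x =>
    {y | D.cls y ⊆ (⋃ i : {i : 𝒮 // ¬ (closure (w i) ∩ D.cls x).Nonempty}, closure (w i.1))ᶜ} ∩
      ⋂ i ∈ {i : 𝒮 | (closure (w i) ∩ D.cls x).Nonempty}, (i : Set X)
  have hcls : ∀ {y z : X}, z ∈ D.cls y → D.cls z = D.cls y := fun {y z} h => cls_eq (D.cls_mem y) h
  refine ⟨range W, ⟨?_, fun x => ⟨W x, mem_range_self x, ?_, ?_⟩⟩, fun y => ?_⟩
  · rintro _ ⟨x, rfl⟩
    refine ⟨(hD.isOpen_core ?_).inter ?_, ?_⟩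
    · exact ((hFf.comp_injective Subtype.val_injective).isClosed_iUnion
        fun i => isClosed_closure).isOpen_compl
    · exact (hFf.finite_nonempty_inter_compact (D.isCompact' _ (D.cls_mem x))).isOpen_biInter
        fun i _ => (h𝒮.1 i i.2).1
    · rintro y ⟨hy1, hy2⟩ z hz
      refine ⟨?_, ?_⟩
      · change D.cls z ⊆ _
        rw [hcls hz]; exact hy1
      · exact mem_iInter₂.2 fun i hi => (h𝒮.1 i i.2).2 y (mem_iInter₂.1 hy2 i hi) hz
  · intro z hz hz'
    obtain ⟨⟨i, hi⟩, hzi⟩ := mem_iUnion.1 hz'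
    exact hi ⟨z, hzi, hz⟩
  · refine mem_iInter₂.2 fun i hi => ?_
    obtain ⟨z, hz, hzx⟩ := hi
    have := (h𝒮.1 i i.2).2 z (hws i hz)
    rw [hcls hzx] at this
    exact this (D.mem_cls x)
  · obtain ⟨i, hi⟩ := mem_iUnion.1 (hwU.ge (mem_univ y))
    refine ⟨i, i.2, ?_⟩
    rintro _ ⟨x, rfl⟩ ⟨hy1, hy2⟩
    have hx : (closure (w i) ∩ D.cls x).Nonempty := by
      by_contra hx
      exact hy1 (D.mem_cls y) (mem_iUnion.2 ⟨⟨i, hx⟩, subset_closure hi⟩)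
    exact fun z hz => mem_iInter₂.1 hz.2 i hx

variable (D) in
/-- A continuous pseudometric inducing a metric on the decomposition space which generates the
quotient topology. -/
structure IsQuotientPseudometric (ρ : X → X → ℝ) : Prop extends IsContPseudometric ρ where
  eq_zero : ∀ x, ∀ y ∈ D.cls x, ρ x y = 0
  thick : ∀ δ > 0, ∃ r > 0, ∀ x, ∃ K ∈ D.pieces, ∀ y, ρ x y < r → ∃ k ∈ K, dist y k < δ

lemma Vanishing.exists_pseudometric (hD : D.Vanishing) {𝒮 : Set (Set X)}
    (h𝒮 : D.IsSatCover 𝒮) :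
    ∃ ρ, D.IsQuotientPseudometric ρ ∧ ∀ x, ∃ S ∈ 𝒮, ∀ y, ρ x y < 1 → y ∈ S := by
  have hcls : ∀ {y z : X}, z ∈ D.cls y → D.cls z = D.cls y := fun {y z} h => cls_eq (D.cls_mem y) h
  have hstep : ∀ (n : ℕ) (𝒯 : {𝒯 : Set (Set X) // D.IsSatCover 𝒯}),
      ∃ 𝒲 : {𝒯 : Set (Set X) // D.IsSatCover 𝒯}, (∀ y, ∃ S ∈ 𝒯.1, ∀ W ∈ 𝒲.1, y ∈ W → W ⊆ S) ∧
        ∀ y, ∃ K ∈ D.pieces, ∀ W ∈ 𝒲.1, y ∈ W → ∀ z ∈ W, ∃ k ∈ K, dist z k < 1 / ((n : ℝ) + 1) := by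
    rintro n ⟨𝒯, h𝒯⟩
    have hn : (0 : ℝ) < 1 / ((n : ℝ) + 1) := by positivity
    obtain ⟨𝒲, h𝒲, h⟩ := hD.exists_barycentric_refinement
      (𝒮 := {S | (IsOpen S ∧ ∀ x ∈ S, D.cls x ⊆ S) ∧ (∃ T ∈ 𝒯, S ⊆ T) ∧
        ∃ K ∈ D.pieces, ∀ z ∈ S, ∃ k ∈ K, dist z k < 1 / ((n : ℝ) + 1)}) ⟨fun S hS => hS.1, by
        intro x
        obtain ⟨T, hT, hxT⟩ := h𝒯.2 x
        refine ⟨{y | D.cls y ⊆ T ∩ Metric.thickening (1 / ((n : ℝ) + 1)) (D.cls x)},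
          ⟨⟨hD.isOpen_core ((h𝒯.1 T hT).1.inter Metric.isOpen_thickening), ?_⟩,
            ⟨T, hT, fun y hy => (hy (D.mem_cls y)).1⟩, D.cls x, D.cls_mem x,
            fun y hy => Metric.mem_thickening_iff.1 (hy (D.mem_cls y)).2⟩,
          subset_inter ((h𝒯.1 T hT).2 x hxT) (Metric.self_subset_thickening hn _)⟩
        intro y hy z hz
        rw [mem_ofPred_eq, hcls hz]; exact hy⟩
    refine ⟨⟨𝒲, h𝒲⟩, fun y => ?_, fun y => ?_⟩
    · obtain ⟨S, ⟨-, ⟨T, hT, hST⟩, -⟩, hS⟩ := h y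
      exact ⟨T, hT, fun W hW hy => (hS W hW hy).trans hST⟩
    · obtain ⟨S, ⟨-, -, K, hK, hSK⟩, hS⟩ := h y
      exact ⟨K, hK, fun W hW hy z hz => hSK z (hS W hW hy hz)⟩
  choose next hnext1 hnext2 using hstep
  let 𝒯 : ℕ → {𝒯 : Set (Set X) // D.IsSatCover 𝒯} := fun n => Nat.rec ⟨𝒮, h𝒮⟩ next n
  have h𝒯 : ∀ n, 𝒯 (n + 1) = next n (𝒯 n) := fun n => rfl
  obtain ⟨ρ, hr, hs, ht, hV, hV'⟩ := exists_pseudometric_of_entourages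
    (fun n x y => ∃ S ∈ (𝒯 n).1, x ∈ S ∧ y ∈ S)
    (fun n x => by obtain ⟨S, hS, hx⟩ := (𝒯 n).2.2 x; exact ⟨S, hS, hx, hx⟩)
    (fun n x y ⟨S, hS, hx, hy⟩ => ⟨S, hS, hy, hx⟩)
    (fun n x y z ⟨S, hS, hx, hy⟩ ⟨S', hS', hy', hz⟩ => by
      obtain ⟨T, hT, h⟩ := hnext1 n (𝒯 n) y
      exact ⟨T, hT, h S (h𝒯 n ▸ hS) hy hx, h S' (h𝒯 n ▸ hS') hy' hz⟩)
  have hball : ∀ x, ∀ r > 0, ∃ O, IsOpen O ∧ D.cls x ⊆ O ∧ ∀ y ∈ O, ρ x y < r := by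
    intro x r hr
    obtain ⟨n, hn⟩ := hV' r hr
    obtain ⟨S, hS, hx⟩ := (𝒯 n).2.2 x
    exact ⟨S, ((𝒯 n).2.1 S hS).1, ((𝒯 n).2.1 S hS).2 x hx, fun y hy => hn x y ⟨S, hS, hx, hy⟩⟩
  have hnn : ∀ x y, 0 ≤ ρ x y := fun x y => by
    have := ht x y x
    rw [hr, hs y x] at this
    linarith
  have hcont : Continuous fun p : X × X => ρ p.1 p.2 := by
    refine Metric.continuous_iff'.2 fun ⟨x, y⟩ ε hε => ?_
    obtain ⟨O, hO, hxO, hO'⟩ := hball x (ε / 2) (half_pos hε)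
    obtain ⟨P, hP, hyP, hP'⟩ := hball y (ε / 2) (half_pos hε)
    filter_upwards [(hO.prod hP).mem_nhds ⟨hxO (D.mem_cls x), hyP (D.mem_cls y)⟩]
    rintro ⟨x', y'⟩ ⟨hx', hy'⟩
    have a1 := hO' x' hx'
    have a2 := hP' y' hy'
    simp only
    rw [Real.dist_eq, abs_lt]
    have b1 := ht x' x y'
    have b2 := ht x y y'
    have b3 := ht x x' y
    have b4 := ht x' y' y
    rw [hs x' x] at b1
    rw [hs y' y] at b4
    constructor <;> linarith
  obtain ⟨r₀, hr₀, hr₀'⟩ := hV 1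
  have hscale : ∀ x y r, ρ x y / r₀ < r ↔ ρ x y < r * r₀ := fun x y r => div_lt_iff₀ hr₀
  refine ⟨fun x y => ρ x y / r₀, ⟨⟨fun x => by simp [hr], fun x y => by rw [hs],
    fun x y z => ?_, hcont.div_const _⟩, fun x y hy => ?_, fun δ hδ => ?_⟩, fun x => ?_⟩
  · rw [← add_div]
    exact div_le_div_of_nonneg_right (ht x y z) hr₀.le
  · have : ρ x y = 0 := le_antisymm (le_of_forall_pos_lt_add fun ε hε => by
      obtain ⟨O, -, hxO, hO⟩ := hball x ε hε
      linarith [hO y (hxO hy)]) (hnn x y)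
    rw [this, zero_div]
  · obtain ⟨n, hn⟩ := exists_nat_one_div_lt hδ
    obtain ⟨r, hr, h⟩ := hV (n + 1)
    refine ⟨r / r₀, div_pos hr hr₀, fun x => ?_⟩
    obtain ⟨K, hK, hxK⟩ := hnext2 n (𝒯 n) x
    refine ⟨K, hK, fun y hy => ?_⟩
    rw [hscale, div_mul_cancel₀ _ hr₀.ne'] at hy
    obtain ⟨S, hS, hxS, hyS⟩ := h x y hy
    obtain ⟨k, hk, hyk⟩ := hxK S (h𝒯 n ▸ hS) hxS y hyS
    exact ⟨k, hk, hyk.trans hn⟩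
  · obtain ⟨T, hT, h⟩ := hnext1 0 (𝒯 0) x
    refine ⟨T, hT, fun y hy => ?_⟩
    rw [hscale, one_mul] at hy
    obtain ⟨S, hS, hxS, hyS⟩ := hr₀' x y hy
    exact h S (h𝒯 0 ▸ hS) hxS hyS

/-- The balls of a quotient pseudometric form a base at each piece. -/
lemma IsQuotientPseudometric.exists_ball_subset {ρ : X → X → ℝ} (hρ : D.IsQuotientPseudometric ρ)
    (hD : D.Vanishing) {W : Set X} (hW : IsOpen W) {x : X} (hx : D.cls x ⊆ W) :
    ∃ r > 0, ∀ y, ρ x y < r → y ∈ W := by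
  obtain ⟨η, hη, hηW⟩ := (D.isCompact' _ (D.cls_mem x)).exists_thickening_subset_open hW hx
  obtain ⟨δ, hδ, h⟩ := hD.mem_or_small x (ε := η / 3) (by positivity)
  obtain ⟨r, hr, hr'⟩ := hρ.thick (min δ (η / 3)) (by positivity)
  refine ⟨r, hr, fun y hy => hηW ?_⟩
  obtain ⟨K, hK, hKr⟩ := hr' x
  obtain ⟨k, hk, hxk⟩ := hKr x (by rw [hρ.refl]; exact hr)
  obtain ⟨k', hk', hyk'⟩ := hKr y hy
  rw [Metric.mem_thickening_iff]
  rcases h K hK k hk (by rw [dist_comm]; exact hxk.trans_le (min_le_left _ _)) with hxK | hsm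
  · rw [cls_eq hK hxK]
    exact ⟨k', hk', hyk'.trans_le ((min_le_right _ _).trans (by linarith))⟩
  · refine ⟨x, D.mem_cls x, ?_⟩
    have h1 := hsm k' hk' k hk
    have h2 := hyk'.trans_le (min_le_right _ _)
    have h3 := hxk.trans_le (min_le_right _ _)
    have h4 := dist_triangle y k' x
    have h5 := dist_triangle k' k x
    rw [dist_comm k x] at h5
    linarith

lemma IsQuotientPseudometric.eq_of_eq_zero {ρ : X → X → ℝ} (hρ : D.IsQuotientPseudometric ρ)
    (hD : D.Vanishing) {x y : X} (h : ρ x y = 0) : D.cls x = D.cls y := by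
  by_contra hne
  have hy : y ∉ D.cls x := fun hy => hne (cls_eq (D.cls_mem x) hy).symm
  obtain ⟨r, hr, hr'⟩ := hρ.exists_ball_subset hD (W := {y}ᶜ) isOpen_compl_singleton (x := x)
    (fun z hz hzy => hy (by rw [← show z = y from hzy]; exact hz))
  exact hr' y (by rw [h]; exact hr) rfl

end Metrization

end Decomposition

/-! ### Bing's shrinking criterion -/

lemma IsContPseudometric.le_of_step {X : Type*} [TopologicalSpace X] {ρ : X → X → ℝ}
    (hρ : IsContPseudometric ρ) {C : ℝ} (hC : 0 ≤ C) {s : ℕ → X}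
    (hs : ∀ n, ρ (s n) (s (n + 1)) ≤ C / 2 / 2 ^ n) {n m : ℕ} (hnm : n ≤ m) :
    ρ (s n) (s m) ≤ C / 2 ^ n := by
  have key : ρ (s n) (s m) ≤ C / 2 ^ n - C / 2 ^ m := by
    induction m, hnm using Nat.le_induction with
    | base => rw [hρ.refl, sub_self]
    | succ m _ ih =>
      have h1 := hρ.tri (s n) (s m) (s (m + 1))
      have h2 := hs m
      have h3 : C / 2 / 2 ^ m = C / 2 ^ m - C / 2 ^ (m + 1) := by
        field_simp
        ring
      linarith
  have : 0 ≤ C / 2 ^ m := by positivity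
  linarith

lemma exists_div_two_pow_lt (C : ℝ) {r : ℝ} (hr : 0 < r) : ∃ n : ℕ, C / 2 ^ n < r := by
  have h : Filter.Tendsto (fun n : ℕ => C / 2 ^ n) Filter.atTop (𝓝 0) := by
    have := (tendsto_pow_atTop_nhds_zero_of_lt_one (r := (1 / 2 : ℝ)) (by norm_num)
      (by norm_num)).const_mul C
    simpa [div_eq_mul_inv] using this
  exact (h.eventually_lt_const hr).exists

/-- Uniform limits of geometrically convergent sequences of continuous maps. -/
lemma exists_continuous_limit {X Y : Type*} [TopologicalSpace X] [MetricSpace Y] [CompleteSpace Y]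
    {f : ℕ → X → Y} (hf : ∀ n, Continuous (f n)) {C : ℝ}
    (h : ∀ n x, dist (f n x) (f (n + 1) x) ≤ C / 2 / 2 ^ n) :
    ∃ g : X → Y, Continuous g ∧ (∀ x, Filter.Tendsto (fun n => f n x) Filter.atTop (𝓝 (g x))) ∧
      ∀ n x, dist (f n x) (g x) ≤ C / 2 ^ n := by
  choose g hg using fun x => cauchySeq_tendsto_of_complete (cauchySeq_of_le_geometric_two (h · x))
  have hd : ∀ n x, dist (f n x) (g x) ≤ C / 2 ^ n := fun n x =>
    dist_le_of_le_geometric_two_of_tendsto (h · x) (hg x) n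
  refine ⟨g, ?_, hg, hd⟩
  have hu : TendstoUniformly f g Filter.atTop := by
    refine Metric.tendstoUniformly_iff.2 fun ε hε => ?_
    obtain ⟨n, hn⟩ := exists_div_two_pow_lt |C| hε
    filter_upwards [Filter.eventually_ge_atTop n] with m hm x
    rw [dist_comm]
    refine (hd m x).trans_lt (lt_of_le_of_lt ?_ hn)
    calc C / 2 ^ m ≤ |C| / 2 ^ m := by gcongr; exact le_abs_self C
      _ ≤ |C| / 2 ^ n := by gcongr; norm_num
  exact hu.continuous (Filter.Frequently.of_forall hf)

namespace Decomposition

section Bing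

variable {X : Type*} [MetricSpace X] {D : Decomposition X}

lemma ShrinksIn.exists_small_move (hs : D.ShrinksIn univ) {ρ : X → X → ℝ}
    (hρ : D.IsQuotientPseudometric ρ) (h : X ≃ₜ X) {a b c : ℝ} (hb : 0 < b) (hc : 0 < c)
    (ha : ∀ K ∈ D.pieces, ∀ x ∈ K, ∀ y ∈ K, dist (h x) (h y) < a) :
    ∃ h' : X ≃ₜ X, (∀ x, dist (h x) (h' x) < a) ∧ (∀ y, ρ (h.symm y) (h'.symm y) < b) ∧
      ∀ K ∈ D.pieces, ∀ x ∈ K, ∀ y ∈ K, dist (h' x) (h' y) < c := by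
  have hd := (isContPseudometric_dist X).comp h.continuous
  obtain ⟨α, -, hα1, hα2⟩ := hs (fun x y => dist (h x) (h y) < a ∧ ρ x y < b)
    (fun x y => dist (h x) (h y) < c)
    (fun K hK _ => by
      obtain ⟨O, hO, hKO, h1⟩ := hd.exists_isOpen_of_isCompact (D.isCompact' K hK) (ha K hK)
      obtain ⟨P, hP, hKP, h2⟩ := hρ.exists_isOpen_of_isCompact (D.isCompact' K hK) (ε := b)
        (fun x hx y hy => by rwa [hρ.eq_zero x y (by rwa [cls_eq hK hx])])
      exact ⟨O ∩ P, hO.inter hP, subset_inter hKO hKP,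
        fun x hx y hy => ⟨h1 x hx.1 y hy.1, h2 x hx.2 y hy.2⟩⟩)
    (fun x _ => hd.exists_isOpen_of_pos x hc)
  refine ⟨α.trans h, fun x => ?_, fun y => ?_, fun K hK => hα2 K hK (subset_univ _)⟩
  · rw [dist_comm]; exact (hα1 x trivial).1
  · have := (hα1 (α.symm (h.symm y)) trivial).2
    rwa [α.apply_symm_apply] at this

/-- Bing's criterion: the quotient map of a shrinkable decomposition of a complete metric space is
approximable by homeomorphisms. -/
theorem ShrinksIn.exists_homeomorph [CompleteSpace X] (hD : D.Vanishing) (hs : D.ShrinksIn univ)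
    {ρ : X → X → ℝ} (hρ : D.IsQuotientPseudometric ρ) {ε : ℝ} (hε : 0 < ε) :
    ∃ g : D.Space ≃ₜ X, ∀ x, ρ (g (D.q x)) x ≤ ε := by
  have hc : ∀ n : ℕ, (0 : ℝ) < 1 / 2 / 2 ^ n := fun n => by positivity
  have hc' : ∀ n : ℕ, 0 < ε / 2 / 2 / 2 ^ n := fun n => by positivity
  obtain ⟨H₀, -, hH₀1, hH₀2⟩ := hs (fun x y => ρ x y < ε / 2) (fun x y => dist x y < 1 / 2 / 2 ^ 0)
    (fun K hK _ => hρ.exists_isOpen_of_isCompact (D.isCompact' K hK)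
        (fun x hx y hy => by rw [hρ.eq_zero x y (by rwa [cls_eq hK hx])]; positivity))
    (fun x _ => (isContPseudometric_dist X).exists_isOpen_of_pos x (hc 0))
  choose next hn1 hn2 hn3 using fun (n : ℕ)
    (h : {h : X ≃ₜ X // ∀ K ∈ D.pieces, ∀ x ∈ K, ∀ y ∈ K, dist (h x) (h y) < 1 / 2 / 2 ^ n}) =>
      hs.exists_small_move hρ h.1 (hc' n) (hc (n + 1)) h.2
  let S : (n : ℕ) →
      {h : X ≃ₜ X // ∀ K ∈ D.pieces, ∀ x ∈ K, ∀ y ∈ K, dist (h x) (h y) < 1 / 2 / 2 ^ n} :=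
    fun n => Nat.rec ⟨H₀, fun K hK => hH₀2 K hK (subset_univ _)⟩
      (fun n h => ⟨next n h, hn3 n h⟩) n
  let H : ℕ → X ≃ₜ X := fun n => (S n).1
  have hH0 : H 0 = H₀ := rfl
  have hHd : ∀ n x, dist (H n x) (H (n + 1) x) ≤ 1 / 2 / 2 ^ n := fun n x => (hn1 n (S n) x).le
  have hHρ : ∀ n y, ρ ((H n).symm y) ((H (n + 1)).symm y) ≤ ε / 2 / 2 / 2 ^ n :=
    fun n y => (hn2 n (S n) y).le
  obtain ⟨h, hh, hlim, hdist⟩ := exists_continuous_limit (fun n => (H n).continuous) hHd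
  have hε2 : 0 ≤ ε / 2 := by positivity
  have hcau : ∀ y n m, n ≤ m → ρ ((H n).symm y) ((H m).symm y) ≤ ε / 2 / 2 ^ n :=
    fun y n m hnm => hρ.le_of_step (s := fun n => (H n).symm y) hε2 (fun n => hHρ n y) hnm
  have hstar : ∀ n x, ρ ((H n).symm (h x)) x ≤ ε / 2 / 2 ^ n := by
    intro n x
    have hcont : Continuous fun y => ρ ((H n).symm y) x :=
      hρ.cont.comp ((H n).symm.continuous.prodMk continuous_const)
    refine le_of_tendsto ((hcont.tendsto _).comp (hlim x)) ?_
    filter_upwards [Filter.eventually_ge_atTop n] with m hm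
    have := hcau (H m x) n m hm
    rwa [(H m).symm_apply_apply] at this
  have hinv : ∀ x y, y ∈ D.cls x → h y = h x := by
    intro x y hy
    refine tendsto_nhds_unique (hlim y) ?_
    refine (hlim x).congr_dist ?_
    refine squeeze_zero (fun _ => dist_nonneg)
      (fun n => ((S n).2 _ (D.cls_mem x) x (D.mem_cls x) y hy).le) ?_
    have := (tendsto_pow_atTop_nhds_zero_of_lt_one (r := (1 / 2 : ℝ)) (by norm_num)
      (by norm_num)).const_mul (1 / 2)
    simpa [div_eq_mul_inv] using this
  have hinj : ∀ x y, h x = h y → D.cls x = D.cls y := by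
    intro x y hxy
    refine hρ.eq_of_eq_zero hD (le_antisymm (le_of_forall_pos_lt_add fun r hr => ?_)
      (hρ.nonneg x y))
    obtain ⟨n, hn⟩ := exists_div_two_pow_lt (ε / 2) (half_pos hr)
    have h1 := hstar n x
    have h2 := hstar n y
    rw [← hxy] at h2
    have h3 := hρ.tri x ((H n).symm (h x)) y
    rw [hρ.symm x ((H n).symm _)] at h3
    linarith
  have hsurj : ∀ y, ∃ z, h z = y := by
    intro y
    have htb : TotallyBounded (range fun n => (H n).symm y) := by
      refine Metric.totallyBounded_iff.2 fun δ hδ => ?_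
      obtain ⟨r, hr, hr'⟩ := hρ.thick (δ / 2) (half_pos hδ)
      obtain ⟨n, hn⟩ := exists_div_two_pow_lt (ε / 2) hr
      obtain ⟨K, hK, hKr⟩ := hr' ((H n).symm y)
      obtain ⟨t, ht, hKt⟩ := Metric.totallyBounded_iff.1 (D.isCompact' K hK).totallyBounded
        (δ / 2) (half_pos hδ)
      refine ⟨t ∪ (fun n => (H n).symm y) '' Iio n, ht.union ((finite_Iio n).image _), ?_⟩
      rintro _ ⟨m, rfl⟩
      rcases lt_or_ge m n with hm | hm
      · exact mem_iUnion₂.2 ⟨_, Or.inr ⟨m, hm, rfl⟩, Metric.mem_ball_self hδ⟩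
      · obtain ⟨k, hk, hmk⟩ := hKr ((H m).symm y) ((hcau y n m hm).trans_lt hn)
        obtain ⟨w, hw, hkw⟩ := mem_iUnion₂.1 (hKt hk)
        refine mem_iUnion₂.2 ⟨w, Or.inl hw, ?_⟩
        have := dist_triangle ((H m).symm y) k w
        rw [Metric.mem_ball] at hkw ⊢
        linarith
    have hcomp : IsCompact (closure (range fun n => (H n).symm y)) :=
      htb.closure.isCompact_of_isClosed isClosed_closure
    obtain ⟨z, -, φ, hφ, hz⟩ := hcomp.tendsto_subseq
      (fun n => subset_closure (mem_range_self n) :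
        ∀ n, (H n).symm y ∈ closure (range fun n => (H n).symm y))
    refine ⟨z, tendsto_nhds_unique ((hh.tendsto z).comp hz) ?_⟩
    refine (tendsto_const_nhds (x := y)).congr_dist ?_
    refine squeeze_zero (g := fun n => 1 / 2 ^ φ n) (fun _ => dist_nonneg) (fun n => ?_) ?_
    · have := hdist (φ n) ((H (φ n)).symm y)
      rwa [(H (φ n)).apply_symm_apply] at this
    · have := (tendsto_pow_atTop_nhds_zero_of_lt_one (r := (1 / 2 : ℝ)) (by norm_num)
        (by norm_num)).comp hφ.tendsto_atTop
      refine this.congr fun n => ?_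
      simp
  let g : D.Space → X := fun p => h (D.nonempty' _ p.2).some
  have hgq : ∀ x, g (D.q x) = h x := fun x => hinv x _ (D.nonempty' _ (D.q x).2).some_mem
  have hgc : Continuous g := D.isQuotientMap_q.continuous_iff.2
    (by rwa [show g ∘ D.q = h from funext hgq])
  have hgi : Function.Injective g := by
    intro p p' hpp
    obtain ⟨x, rfl⟩ := D.q_surjective p
    obtain ⟨y, rfl⟩ := D.q_surjective p'
    rw [hgq, hgq] at hpp
    exact D.q_eq_iff.2 (hinj x y hpp)
  have hgs : Function.Surjective g := fun y => by
    obtain ⟨z, hz⟩ := hsurj y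
    exact ⟨D.q z, by rw [hgq, hz]⟩
  have hgo : IsOpenMap g := by
    intro V hV
    rw [isOpen_iff_mem_nhds]
    rintro _ ⟨p, hp, rfl⟩
    obtain ⟨x, rfl⟩ := D.q_surjective p
    rw [hgq]
    obtain ⟨r, hr, hr'⟩ := hρ.exists_ball_subset hD (hV.preimage D.continuous_q) (x := x)
      (fun y hy => by
        rw [mem_preimage, D.q_eq_iff.2 (cls_eq (D.cls_mem x) hy)]; exact hp)
    obtain ⟨n, hn⟩ := exists_div_two_pow_lt (ε / 2) (half_pos hr)
    have hN : IsOpen {y | ρ ((H n).symm y) x < r / 2} :=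
      isOpen_lt (hρ.cont.comp ((H n).symm.continuous.prodMk continuous_const)) continuous_const
    refine Filter.mem_of_superset (hN.mem_nhds ((hstar n x).trans_lt hn)) fun y hy => ?_
    obtain ⟨z, rfl⟩ := hsurj y
    refine ⟨D.q z, hr' z ?_, hgq z⟩
    have h1 := hstar n z
    have h2 : ρ ((H n).symm (h z)) x < r / 2 := hy
    have h3 := hρ.tri x ((H n).symm (h z)) z
    rw [hρ.symm x ((H n).symm _)] at h3
    linarith
  refine ⟨(Equiv.ofBijective g ⟨hgi, hgs⟩).toHomeomorphOfContinuousOpen hgc hgo, fun x => ?_⟩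
  change ρ (g (D.q x)) x ≤ ε
  rw [hgq]
  have h1 := hstar 0 x
  have h2 := hH₀1 ((H 0).symm (h x)) trivial
  rw [← hH0, (H 0).apply_symm_apply] at h2
  have h3 := hρ.tri (h x) ((H 0).symm (h x)) x
  rw [pow_zero, div_one] at h1
  linarith

end Bing

end Decomposition

/-! ### Transport of decompositions along homeomorphisms -/

namespace Decomposition

section Transport

variable {X : Type*} [TopologicalSpace X]

/-- The decomposition whose pieces are the preimages of the pieces of `D`. -/
def comap (D : Decomposition X) (Φ : X ≃ₜ X) : Decomposition X where
  pieces := {K | Φ '' K ∈ D.pieces}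
  nonempty' K hK := image_nonempty.1 (D.nonempty' _ hK)
  isCompact' K hK := Φ.isCompact_image.1 (D.isCompact' _ hK)
  disjoint' K hK L hL h := (disjoint_image_iff Φ.injective).1
    (D.disjoint' _ hK _ hL fun h' => h (Φ.injective.image_injective h'))
  covers x := ⟨Φ ⁻¹' D.cls (Φ x), by
    change Φ '' _ ∈ D.pieces
    rw [Φ.image_preimage]; exact D.cls_mem _, D.mem_cls _⟩

lemma mem_comap_pieces {D : Decomposition X} {Φ : X ≃ₜ X} {K : Set X} :
    K ∈ (D.comap Φ).pieces ↔ Φ '' K ∈ D.pieces := Iff.rfl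

lemma preimage_mem_comap_pieces {D : Decomposition X} {Φ : X ≃ₜ X} {K : Set X} :
    Φ ⁻¹' K ∈ (D.comap Φ).pieces ↔ K ∈ D.pieces := by
  rw [mem_comap_pieces, Φ.image_preimage]

lemma comap_cls (D : Decomposition X) (Φ : X ≃ₜ X) (x : X) :
    (D.comap Φ).cls x = Φ ⁻¹' D.cls (Φ x) :=
  cls_eq (preimage_mem_comap_pieces.2 (D.cls_mem _)) (D.mem_cls (Φ x))

/-- The properties of dense tame decompositions used in the construction of lifts. -/
structure IsGood (D : Decomposition X) (𝒦 : Set (Set X)) : Prop where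
  vanishing : D.Vanishing
  shrinksIn : ∀ U, IsOpen U → (∀ x ∈ U, D.cls x ⊆ U) → D.ShrinksIn U
  mem : ∀ K ∈ D.pieces, ¬ K.Subsingleton → K ∈ 𝒦
  exists_nondeg : ∀ O, IsOpen O → ∀ x, D.cls x ⊆ O → ∃ L ∈ D.pieces, ¬ L.Subsingleton ∧ L ⊆ O

lemma KTame.isGood {X : Type*} [MetricSpace X] {D : Decomposition X} {𝒦 : Set (Set X)}
    (hD : D.KTame 𝒦) (hd : D.IsDenseDecomp) : D.IsGood 𝒦 where
  vanishing := hD.1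
  shrinksIn U hU hsat := by
    have hsat' : D.Saturated U := fun K hK ⟨x, hx, hxU⟩ => by
      rw [← cls_eq hK hx]; exact hsat x hxU
    exact (hD.2.1 U hU hsat').shrinksIn hD.1 hU hsat'
  mem := hD.2.2
  exists_nondeg O hO x hx := by
    have hV : IsOpen {p : D.Space | p.1 ⊆ O} := by
      rw [← D.isQuotientMap_q.isOpen_preimage]
      exact hD.1.isOpen_core hO
    obtain ⟨p, hpO, hp⟩ := hd.inter_open_nonempty _ hV ⟨D.q x, hx⟩
    exact ⟨p.1, p.2, hp, hpO⟩

lemma Vanishing.comap {D : Decomposition X} (hD : D.Vanishing) (Φ : X ≃ₜ X) :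
    (D.comap Φ).Vanishing := by
  intro 𝒰 ho hc x
  obtain ⟨V, hV, h⟩ := hD ((fun u => Φ '' u) '' 𝒰)
    (by rintro _ ⟨u, hu, rfl⟩; exact Φ.isOpenMap _ (ho u hu))
    (eq_univ_of_forall fun y => by
      obtain ⟨u, hu, hy⟩ := hc.ge (mem_univ (Φ.symm y))
      exact ⟨Φ '' u, mem_image_of_mem _ hu, Φ.symm y, hy, Φ.apply_symm_apply y⟩) (Φ x)
  refine ⟨Φ ⁻¹' V, Φ.continuous.continuousAt hV, fun K hK hKu L hL hLu hVK hVL =>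
    Φ.injective.image_injective (h _ hK ?_ _ hL ?_ ?_ ?_)⟩
  · rintro _ ⟨u, hu, rfl⟩ hs
    exact hKu u hu ((image_subset_image_iff Φ.injective).1 hs)
  · rintro _ ⟨u, hu, rfl⟩ hs
    exact hLu u hu ((image_subset_image_iff Φ.injective).1 hs)
  · obtain ⟨z, hz, hzK⟩ := hVK
    exact ⟨Φ z, hz, mem_image_of_mem _ hzK⟩
  · obtain ⟨z, hz, hzL⟩ := hVL
    exact ⟨Φ z, hz, mem_image_of_mem _ hzL⟩

lemma ShrinksIn.comap {D : Decomposition X} {Φ : X ≃ₜ X} {U : Set X} (hD : D.ShrinksIn (Φ '' U)) :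
    (D.comap Φ).ShrinksIn U := by
  intro E F hE hF
  obtain ⟨h, h1, h2, h3⟩ := hD (fun x y => E (Φ.symm x) (Φ.symm y))
    (fun x y => F (Φ.symm x) (Φ.symm y))
    (fun K hK hKU => by
      obtain ⟨O, hO, hKO, h⟩ := hE (Φ ⁻¹' K) (preimage_mem_comap_pieces.2 hK)
        (by rw [← preimage_image_eq U Φ.injective]; exact preimage_mono hKU)
      refine ⟨Φ.symm ⁻¹' O, hO.preimage Φ.symm.continuous, fun x hx => hKO ?_,
        fun x hx y hy => h _ hx _ hy⟩
      rw [mem_preimage, Φ.apply_symm_apply]; exact hx)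
    (by
      rintro _ ⟨x, hx, rfl⟩
      obtain ⟨O, hO, hxO, h⟩ := hF x hx
      refine ⟨Φ.symm ⁻¹' O, hO.preimage Φ.symm.continuous, ?_, fun x hx y hy => h _ hx _ hy⟩
      rwa [mem_preimage, Φ.symm_apply_apply])
  refine ⟨(Φ.trans h).trans Φ.symm, fun x hx => ?_, fun x hx => ?_, fun K hK hKU x hx y hy => ?_⟩
  · change Φ.symm (h (Φ x)) = x
    rw [h1 _ (fun ⟨y, hy, hyx⟩ => hx (Φ.injective hyx ▸ hy)), Φ.symm_apply_apply]
  · have := h2 (Φ x) (mem_image_of_mem _ hx)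
    rwa [Φ.symm_apply_apply] at this
  · exact h3 _ hK (image_mono hKU) _ (mem_image_of_mem _ hx) _ (mem_image_of_mem _ hy)

lemma IsGood.comap {D : Decomposition X} {𝒦 : Set (Set X)} (hD : D.IsGood 𝒦)
    (h𝒦 : AmbientlyInvariant 𝒦) (Φ : X ≃ₜ X) : (D.comap Φ).IsGood 𝒦 where
  vanishing := hD.vanishing.comap Φ
  shrinksIn U hU hsat := by
    refine (hD.shrinksIn _ (Φ.isOpenMap _ hU) ?_).comap
    rintro _ ⟨x, hx, rfl⟩ y hy
    refine ⟨Φ.symm y, hsat x hx ?_, Φ.apply_symm_apply y⟩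
    rw [comap_cls, mem_preimage, Φ.apply_symm_apply]; exact hy
  mem K hK hn := by
    have := h𝒦 Φ.symm _ (hD.mem _ hK fun h => hn (subsingleton_of_image Φ.injective K h))
    rwa [← image_comp, Φ.symm_comp_self, image_id] at this
  exists_nondeg O hO x hx := by
    obtain ⟨L, hL, hn, hLO⟩ := hD.exists_nondeg (Φ '' O) (Φ.isOpenMap _ hO) (Φ x) (fun y hy =>
      ⟨Φ.symm y, hx (by rw [comap_cls, mem_preimage, Φ.apply_symm_apply]; exact hy),
        Φ.apply_symm_apply y⟩)
    refine ⟨Φ ⁻¹' L, preimage_mem_comap_pieces.2 hL, fun h => hn ?_, ?_⟩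
    · rw [← Φ.image_preimage L]; exact h.image _
    · rw [← preimage_image_eq O Φ.injective]; exact preimage_mono hLO

end Transport

end Decomposition

/-! ### Locally unique families and gluing of homeomorphisms -/

/-- Each point has a neighborhood meeting at most one member of the family. -/
def LocallyUnique {X ι : Type*} [TopologicalSpace X] (F : ι → Set X) : Prop :=
  ∀ x, ∃ V, IsOpen V ∧ x ∈ V ∧ ∀ i j, (V ∩ F i).Nonempty → (V ∩ F j).Nonempty → i = j

section Gluing

variable {X ι : Type*}

lemma LocallyUnique.eq_of_mem [TopologicalSpace X] {F : ι → Set X} (hF : LocallyUnique F)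
    {x : X} {i j : ι} (hi : x ∈ F i) (hj : x ∈ F j) : i = j := by
  obtain ⟨V, -, hxV, h⟩ := hF x
  exact h i j ⟨x, hxV, hi⟩ ⟨x, hxV, hj⟩

lemma LocallyUnique.mono [TopologicalSpace X] {F G : ι → Set X} (hF : LocallyUnique F)
    (h : ∀ i, G i ⊆ F i) : LocallyUnique G := fun x => by
  obtain ⟨V, hV, hxV, hV'⟩ := hF x
  exact ⟨V, hV, hxV, fun i j hi hj => hV' i j (hi.mono (inter_subset_inter_right _ (h i)))
    (hj.mono (inter_subset_inter_right _ (h j)))⟩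

lemma LocallyUnique.isClosed_biUnion [TopologicalSpace X] {F : ι → Set X} (hF : LocallyUnique F)
    (hc : ∀ i, IsClosed (F i)) (s : Set ι) : IsClosed (⋃ i ∈ s, F i) := by
  rw [← isOpen_compl_iff, isOpen_iff_mem_nhds]
  intro x hx
  obtain ⟨V, hV, hxV, h⟩ := hF x
  by_cases hi : ∃ i ∈ s, (V ∩ F i).Nonempty
  · obtain ⟨i, his, hi⟩ := hi
    have hxi : x ∉ F i := fun h => hx (mem_iUnion₂.2 ⟨i, his, h⟩)
    refine Filter.mem_of_superset ((hV.inter (hc i).isOpen_compl).mem_nhds ⟨hxV, hxi⟩) ?_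
    rintro y ⟨hyV, hyi⟩ hy
    obtain ⟨j, -, hj⟩ := mem_iUnion₂.1 hy
    exact hyi (h i j hi ⟨y, hyV, hj⟩ ▸ hj)
  · refine Filter.mem_of_superset (hV.mem_nhds hxV) fun y hyV hy => ?_
    obtain ⟨j, hjs, hj⟩ := mem_iUnion₂.1 hy
    exact hi ⟨j, hjs, y, hyV, hj⟩

lemma LocallyUnique.exists_open_expansion [MetricSpace X] {F O : ι → Set X} (hF : LocallyUnique F)
    (hc : ∀ i, IsClosed (F i)) (hO : ∀ i, IsOpen (O i)) (hFO : ∀ i, F i ⊆ O i) :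
    ∃ W : ι → Set X, LocallyUnique W ∧ ∀ i, IsOpen (W i) ∧ F i ⊆ W i ∧ W i ⊆ O i := by
  let R : ι → Set X := fun i => ⋃ j ∈ {j | j ≠ i}, F j
  let P : ι → Set X := fun i => {x | Metric.infEDist x (F i) < Metric.infEDist x (R i)}
  have hP : ∀ i, IsOpen (P i) := fun i =>
    isOpen_lt Metric.continuous_infEDist Metric.continuous_infEDist
  have hFP : ∀ i, F i ⊆ P i := by
    intro i x hx
    have hR : IsClosed (R i) := hF.isClosed_biUnion hc _
    change Metric.infEDist x (F i) < Metric.infEDist x (R i)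
    rw [Metric.infEDist_zero_of_mem hx, pos_iff_ne_zero]
    intro h
    rw [← Metric.mem_iff_infEDist_zero_of_closed hR] at h
    obtain ⟨j, hj, hxj⟩ := mem_iUnion₂.1 h
    exact hj (hF.eq_of_mem hxj hx)
  have hPd : ∀ i j x, x ∈ P i → x ∈ P j → i = j := by
    intro i j x hi hj
    by_contra hne
    have h1 : Metric.infEDist x (R i) ≤ Metric.infEDist x (F j) :=
      Metric.infEDist_anti (subset_biUnion_of_mem (u := F) (show j ∈ {j | j ≠ i} from Ne.symm hne))
    have h2 : Metric.infEDist x (R j) ≤ Metric.infEDist x (F i) :=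
      Metric.infEDist_anti (subset_biUnion_of_mem (u := F) (show i ∈ {i | i ≠ j} from hne))
    exact lt_irrefl _ (((lt_of_lt_of_le hi h1).trans hj).trans_le h2)
  have hT : IsClosed (⋃ i ∈ (univ : Set ι), F i) := hF.isClosed_biUnion hc _
  obtain ⟨N, hN, hTN, hNP⟩ := normal_exists_closure_subset hT (isOpen_iUnion hP)
    (iUnion₂_subset fun i _ => (hFP i).trans (subset_iUnion P i))
  refine ⟨fun i => P i ∩ N ∩ O i, fun x => ?_, fun i => ⟨((hP i).inter hN).inter (hO i),
    fun x hx => ⟨⟨hFP i hx, hTN (mem_iUnion₂.2 ⟨i, trivial, hx⟩)⟩, hFO i hx⟩, inter_subset_right⟩⟩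
  by_cases hx : x ∈ closure N
  · obtain ⟨i, hi⟩ := mem_iUnion.1 (hNP hx)
    have : ∀ j, (P i ∩ (P j ∩ N ∩ O j)).Nonempty → i = j := fun j ⟨y, hy, hy'⟩ =>
      hPd i j y hy hy'.1.1
    exact ⟨P i, hP i, hi, fun j k hj hk => (this j hj).symm.trans (this k hk)⟩
  · exact ⟨(closure N)ᶜ, isClosed_closure.isOpen_compl, hx,
      fun i j ⟨y, hy, hy'⟩ _ => (hy (subset_closure hy'.1.2)).elim⟩

lemma Homeomorph.mem_of_support [TopologicalSpace X] {h : X ≃ₜ X} {W : Set X}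
    (hh : ∀ x ∉ W, h x = x) {x : X} (hx : x ∈ W) : h x ∈ W := by
  by_contra hn
  exact hn (by rwa [h.injective (hh _ hn)])

lemma Homeomorph.symm_support [TopologicalSpace X] {h : X ≃ₜ X} {W : Set X}
    (hh : ∀ x ∉ W, h x = x) : ∀ x ∉ W, h.symm x = x := fun x hx => by
  rw [h.symm_apply_eq, hh x hx]

open Classical in
/-- The map equal to `g i` on `W i` and to the identity off the union of all `W i`. -/
def glue (W : ι → Set X) (g : ι → X → X) (x : X) : X :=
  if h : ∃ i, x ∈ W i then g h.choose x else x

lemma glue_of_mem [TopologicalSpace X] {W : ι → Set X} (hW : LocallyUnique W) (g : ι → X → X)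
    {i : ι} {x : X} (hx : x ∈ W i) : glue W g x = g i x := by
  have h : ∃ i, x ∈ W i := ⟨i, hx⟩
  rw [glue, dif_pos h, hW.eq_of_mem h.choose_spec hx]

lemma glue_of_notMem {W : ι → Set X} (g : ι → X → X) {x : X} (hx : ∀ i, x ∉ W i) :
    glue W g x = x := dif_neg fun ⟨i, hi⟩ => hx i hi

lemma continuous_glue [TopologicalSpace X] {W : ι → Set X} (hW : LocallyUnique W) {g : ι → X → X}
    (hg : ∀ i, Continuous (g i)) (hs : ∀ i, ∀ x ∉ W i, g i x = x) : Continuous (glue W g) := by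
  refine continuous_iff_continuousAt.2 fun x => ?_
  obtain ⟨V, hV, hxV, h⟩ := hW x
  by_cases hi : ∃ i, (V ∩ W i).Nonempty
  · obtain ⟨i, hi⟩ := hi
    refine (hg i).continuousAt.congr (Filter.mem_of_superset (hV.mem_nhds hxV) fun y hy => ?_)
    by_cases hyi : y ∈ W i
    · exact (glue_of_mem hW g hyi).symm
    · refine (hs i y hyi).trans (glue_of_notMem g fun j hj => hyi ?_).symm
      rwa [h i j hi ⟨y, hy, hj⟩]
  · refine continuousAt_id.congr (Filter.mem_of_superset (hV.mem_nhds hxV) fun y hy => ?_)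
    exact (glue_of_notMem g fun j hj => hi ⟨j, y, hy, hj⟩).symm

lemma glue_leftInverse [TopologicalSpace X] {W : ι → Set X} (hW : LocallyUnique W)
    (g : ι → X ≃ₜ X) (hs : ∀ i, ∀ x ∉ W i, g i x = x) :
    Function.LeftInverse (glue W fun i => (g i).symm) (glue W fun i => g i) := by
  intro x
  by_cases h : ∃ i, x ∈ W i
  · obtain ⟨i, hi⟩ := h
    rw [glue_of_mem hW _ hi, glue_of_mem hW _ (Homeomorph.mem_of_support (hs i) hi),
      (g i).symm_apply_apply]
  · have h' : ∀ i, x ∉ W i := fun i hi => h ⟨i, hi⟩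
    rw [glue_of_notMem _ h', glue_of_notMem _ h']

lemma LocallyUnique.exists_glued_homeomorph [TopologicalSpace X] {W : ι → Set X}
    (hW : LocallyUnique W) (g : ι → X ≃ₜ X) (hs : ∀ i, ∀ x ∉ W i, g i x = x) :
    ∃ G : X ≃ₜ X, (∀ i, ∀ x ∈ W i, G x = g i x) ∧ ∀ x, (∀ i, x ∉ W i) → G x = x :=
  ⟨{ toFun := glue W fun i => g i
     invFun := glue W fun i => (g i).symm
     left_inv := glue_leftInverse hW g hs
     right_inv := glue_leftInverse hW (fun i => (g i).symm)
      fun i => Homeomorph.symm_support (hs i)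
     continuous_toFun := continuous_glue hW (fun i => (g i).continuous) hs
     continuous_invFun := continuous_glue hW (fun i => (g i).symm.continuous)
      fun i => Homeomorph.symm_support (hs i) },
    fun _ _ hx => glue_of_mem hW (fun i => g i) hx, fun _ hx => glue_of_notMem (fun i => g i) hx⟩

end Gluing

/-! ### Moving members of a tame family onto each other -/

section Matching

variable {X : Type*} [TopologicalSpace X]

/-- The orbit of `x` under the homeomorphisms supported in `W`. -/
def supportOrbit (W : Set X) (x : X) : Set X := {y | ∃ h : X ≃ₜ X, (∀ z ∉ W, h z = z) ∧ h x = y}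

lemma Homeomorph.trans_support {g h : X ≃ₜ X} {W : Set X} (hg : ∀ x ∉ W, g x = x)
    (hh : ∀ x ∉ W, h x = x) : ∀ x ∉ W, (g.trans h) x = x := fun x hx => by
  rw [Homeomorph.trans_apply, hg x hx, hh x hx]

lemma supportOrbit_symm {W : Set X} {x y : X} (h : y ∈ supportOrbit W x) :
    x ∈ supportOrbit W y := by
  obtain ⟨g, hg, rfl⟩ := h
  exact ⟨g.symm, Homeomorph.symm_support hg, g.symm_apply_apply x⟩

lemma supportOrbit_trans {W : Set X} {x y z : X} (h : y ∈ supportOrbit W x)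
    (h' : z ∈ supportOrbit W y) : z ∈ supportOrbit W x := by
  obtain ⟨g, hg, rfl⟩ := h
  obtain ⟨k, hk, rfl⟩ := h'
  exact ⟨g.trans k, Homeomorph.trans_support hg hk, rfl⟩

lemma mem_supportOrbit_self (W : Set X) (x : X) : x ∈ supportOrbit W x :=
  ⟨Homeomorph.refl X, fun _ _ => rfl, rfl⟩

lemma StronglyLocallyHomogeneous.supportOrbit_mem_nhds (hX : StronglyLocallyHomogeneous X)
    {W : Set X} (hW : IsOpen W) {x : X} (hx : x ∈ W) : supportOrbit W x ∈ 𝓝 x := by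
  obtain ⟨U, hU, -, h⟩ := hX x W (hW.mem_nhds hx)
  refine Filter.mem_of_superset hU fun y hy => ?_
  obtain ⟨g, hg, hg'⟩ := h y hy
  exact ⟨g, hg', hg⟩

lemma supportOrbit_subset {W : Set X} {x : X} (hx : x ∈ W) : supportOrbit W x ⊆ W := by
  rintro _ ⟨g, hg, rfl⟩
  exact Homeomorph.mem_of_support hg hx

lemma StronglyLocallyHomogeneous.isOpen_supportOrbit (hX : StronglyLocallyHomogeneous X)
    {W : Set X} (hW : IsOpen W) {x : X} (hx : x ∈ W) : IsOpen (supportOrbit W x) :=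
  isOpen_iff_mem_nhds.2 fun _ hy =>
    Filter.mem_of_superset (hX.supportOrbit_mem_nhds hW (supportOrbit_subset hx hy))
      fun _ hz => supportOrbit_trans hy hz

lemma StronglyLocallyHomogeneous.isOpen_diff_supportOrbit (hX : StronglyLocallyHomogeneous X)
    {W : Set X} (hW : IsOpen W) {x : X} : IsOpen (W \ supportOrbit W x) :=
  isOpen_iff_mem_nhds.2 fun _ hy =>
    Filter.mem_of_superset (hX.supportOrbit_mem_nhds hW hy.1) fun _ hz =>
      ⟨supportOrbit_subset hy.1 hz, fun h => hy.2 (supportOrbit_trans h (supportOrbit_symm hz))⟩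

lemma IsTameFamily.exists_image_eq {𝒦 : Set (Set X)} (h𝒦 : IsTameFamily 𝒦)
    (hX : StronglyLocallyHomogeneous X) {W : Set X} (hW : IsOpen W) {K L : Set X} (hK : K ∈ 𝒦)
    (hL : L ∈ 𝒦) (hKW : K ⊆ W) (hLW : L ⊆ W) {x y : X} (hx : x ∈ K) (hy : y ∈ L)
    (hxy : y ∈ supportOrbit W x) :
    ∃ g : X ≃ₜ X, (∀ z ∉ W, g z = z) ∧ g '' K = L := by
  obtain ⟨U, hU, -, hshift⟩ := h𝒦.2.2.2.1 x W (hW.mem_nhds (hKW hx))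
  have key : ∀ M ∈ 𝒦, M ⊆ W → ∀ z ∈ M, z ∈ supportOrbit W x →
      ∃ g : X ≃ₜ X, (∀ z ∉ W, g z = z) ∧ g '' M ⊆ U := by
    intro M hM hMW z hz hzx
    obtain ⟨h, hh, v, hv, hMv⟩ := h𝒦.2.2.1 M hM W hW hMW
      ({v | (IsOpen v ∧ v ⊆ W) ∧ ∃ g : X ≃ₜ X, (∀ z ∉ W, g z = z) ∧ g '' v ⊆ U} ∪
        {W \ supportOrbit W x})
      (by
        rintro v (hv | rfl)
        · exact hv.1
        · exact ⟨hX.isOpen_diff_supportOrbit hW, sdiff_subset⟩)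
      (by
        intro w hw
        by_cases hwx : w ∈ supportOrbit W x
        · obtain ⟨g, hg, rfl⟩ := hwx
          refine ⟨g '' (interior U ∩ W), Or.inl ⟨⟨g.isOpenMap _ (isOpen_interior.inter hW), ?_⟩,
            g.symm, Homeomorph.symm_support hg, ?_⟩,
            mem_image_of_mem _ ⟨mem_interior_iff_mem_nhds.2 hU, hKW hx⟩⟩
          · rintro _ ⟨u, hu, rfl⟩
            exact Homeomorph.mem_of_support hg hu.2
          · rw [← image_comp, g.symm_comp_self, image_id]
            exact inter_subset_left.trans interior_subset
        · exact ⟨_, Or.inr rfl, hw, hwx⟩)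
    rcases hv with ⟨-, g, hg, hgv⟩ | rfl
    · refine ⟨h.trans g, Homeomorph.trans_support hh hg, ?_⟩
      rw [show ⇑(h.trans g) = g ∘ h from rfl, image_comp]
      exact (image_mono hMv).trans hgv
    · exact absurd (supportOrbit_trans hzx ⟨h, hh, rfl⟩) (hMv (mem_image_of_mem _ hz)).2
  obtain ⟨g, hg, hgK⟩ := key K hK hKW x hx (mem_supportOrbit_self W x)
  obtain ⟨k, hk, hkL⟩ := key L hL hLW y hy hxy
  obtain ⟨s, hs, hs'⟩ := hshift _ (h𝒦.2.1 g K hK) _ (h𝒦.2.1 k L hL) hgK hkL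
  refine ⟨(g.trans s).trans k.symm, Homeomorph.trans_support (Homeomorph.trans_support hg hs')
    (Homeomorph.symm_support hk), ?_⟩
  rw [show ⇑((g.trans s).trans k.symm) = k.symm ∘ s ∘ g from rfl, image_comp, image_comp, hs, ← image_comp,
    k.symm_comp_self, image_id]

lemma Decomposition.IsGood.exists_image_mem {𝒦 : Set (Set X)} {D : Decomposition X}
    (hD : D.IsGood 𝒦) (h𝒦 : IsTameFamily 𝒦) (hX : StronglyLocallyHomogeneous X) {W : Set X}
    (hW : IsOpen W) {K : Set X} (hK : K ∈ 𝒦) (hKW : K ⊆ W) {x : X} (hx : x ∈ K)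
    (hxW : D.cls x ⊆ W) :
    ∃ g : X ≃ₜ X, (∀ z ∉ W, g z = z) ∧ g '' K ∈ D.pieces := by
  by_cases hn : (D.cls x).Subsingleton
  · have hsub : D.cls x ⊆ supportOrbit W x := fun y hy => by
      rw [hn hy (D.mem_cls x)]; exact mem_supportOrbit_self W x
    obtain ⟨L, hL, hLn, hLW⟩ := hD.exists_nondeg _ (hX.isOpen_supportOrbit hW (hKW hx)) x hsub
    obtain ⟨y, hy⟩ := D.nonempty' L hL
    obtain ⟨g, hg, hgK⟩ := h𝒦.exists_image_eq hX hW hK (hD.mem L hL hLn) hKW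
      (hLW.trans (supportOrbit_subset (hKW hx))) hx hy (hLW hy)
    exact ⟨g, hg, hgK ▸ hL⟩
  · obtain ⟨g, hg, hgK⟩ := h𝒦.exists_image_eq hX hW hK (hD.mem _ (D.cls_mem x) hn) hKW hxW hx
      (D.mem_cls x) (mem_supportOrbit_self W x)
    exact ⟨g, hg, hgK ▸ D.cls_mem x⟩

end Matching

/-! ### Matching the large pieces of two decompositions -/

/-- The set `K` has diameter less than `ε` with respect to `ρ`, in the strict pointwise sense. -/
def IsSmall {X : Type*} (ρ : X → X → ℝ) (ε : ℝ) (K : Set X) : Prop :=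
  ∀ y ∈ K, ∀ z ∈ K, ρ y z < ε

namespace Decomposition

section Steps

variable {X : Type*}

/-- The closed set `S` is a union of common pieces of `A` and `B`. -/
structure MatchedOn [TopologicalSpace X] (A B : Decomposition X) (S : Set X) : Prop where
  isClosed : IsClosed S
  mem : ∀ K ∈ A.pieces, (K ∩ S).Nonempty → K ⊆ S ∧ K ∈ B.pieces

lemma MatchedOn.symm [TopologicalSpace X] {A B : Decomposition X} {S : Set X}
    (h : A.MatchedOn B S) : B.MatchedOn A S where
  isClosed := h.isClosed
  mem := by
    rintro L hL ⟨x, hxL, hxS⟩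
    obtain ⟨h1, h2⟩ := h.mem _ (A.cls_mem x) ⟨x, A.mem_cls x, hxS⟩
    rw [eq_of_mem_of_mem hL h2 hxL (A.mem_cls x)]
    exact ⟨h1, A.cls_mem x⟩

lemma MatchedOn.subset_or [TopologicalSpace X] {A B : Decomposition X} {S : Set X}
    (h : A.MatchedOn B S) {K : Set X} (hK : K ∈ A.pieces) :
    (K ⊆ S ∧ K ∈ B.pieces) ∨ K ⊆ Sᶜ := by
  by_cases hn : (K ∩ S).Nonempty
  · exact Or.inl (h.mem K hK hn)
  · exact Or.inr fun x hx hxS => hn ⟨x, hx, hxS⟩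

lemma MatchedOn.cls_subset_compl [TopologicalSpace X] {A B : Decomposition X} {S : Set X}
    (h : A.MatchedOn B S) : ∀ x ∈ Sᶜ, A.cls x ⊆ Sᶜ := fun x hx =>
  (h.subset_or (A.cls_mem x)).resolve_left fun h => hx (h.1 (A.mem_cls x))

lemma matchedOn_empty [TopologicalSpace X] (A B : Decomposition X) : A.MatchedOn B ∅ :=
  ⟨isClosed_empty, fun _ _ ⟨_, hx⟩ => hx.2.elim⟩

lemma MatchedOn.union [TopologicalSpace X] {A B : Decomposition X} {S : Set X}
    (h : A.MatchedOn B S) {𝒞 : Set (Set X)} (h𝒞 : LocallyUnique fun K : 𝒞 => (K : Set X))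
    (hA : ∀ K ∈ 𝒞, IsClosed K ∧ K ∈ A.pieces ∧ K ∈ B.pieces) : A.MatchedOn B (S ∪ ⋃₀ 𝒞) where
  isClosed := by
    refine h.isClosed.union ?_
    have := h𝒞.isClosed_biUnion (fun K => (hA K K.2).1) univ
    rwa [biUnion_univ, ← sUnion_eq_iUnion] at this
  mem := by
    rintro K hK ⟨x, hxK, hxS | ⟨L, hL, hxL⟩⟩
    · obtain ⟨h1, h2⟩ := h.mem K hK ⟨x, hxK, hxS⟩
      exact ⟨h1.trans subset_union_left, h2⟩
    · rw [eq_of_mem_of_mem hK (hA L hL).2.1 hxK hxL]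
      exact ⟨(subset_sUnion_of_mem hL).trans subset_union_right, (hA L hL).2.2⟩

variable [MetricSpace X] {A B : Decomposition X} {𝒦 : Set (Set X)}

/-- A discrete family of members of `𝒦` can be moved onto pieces of `B`. -/
lemma IsGood.exists_matching (hB : B.IsGood 𝒦) (h𝒦 : IsTameFamily 𝒦)
    (hX : StronglyLocallyHomogeneous X) {S : Set X} (hS : A.MatchedOn B S) {τ : X → X → ℝ}
    (hτ : IsContPseudometric τ) {ε : ℝ} (hε : 0 < ε)
    (hAτ : ∀ K ∈ A.pieces, K ⊆ Sᶜ → IsSmall τ ε K) (hBτ : ∀ K ∈ B.pieces, K ⊆ Sᶜ → IsSmall τ ε K)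
    {𝒞 : Set (Set X)} (h𝒞 : LocallyUnique fun K : 𝒞 => (K : Set X))
    (h𝒞A : ∀ K ∈ 𝒞, K ∈ A.pieces ∧ K ⊆ Sᶜ ∧ K ∈ 𝒦) :
    ∃ γ : X ≃ₜ X, (∀ x ∈ S, γ x = x) ∧ (∀ x, τ (γ x) x ≤ 6 * ε) ∧ ∀ K ∈ 𝒞, γ '' K ∈ B.pieces := by
  obtain ⟨β, hβ1, hβ2, hβ3⟩ := hB.shrinksIn Sᶜ hS.isClosed.isOpen_compl hS.symm.cls_subset_compl
    (fun x y => τ x y < ε) (fun y z => ∀ K L : 𝒞, y ∈ (K : Set X) → z ∈ (L : Set X) → K = L)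
    (fun K hK hKS => hτ.exists_isOpen_of_isCompact (B.isCompact' K hK) (hBτ K hK hKS))
    (fun x _ => by
      obtain ⟨V, hV, hxV, h⟩ := h𝒞 x
      exact ⟨V, hV, hxV, fun y hy z hz K L hyK hzL => h K L ⟨y, hy, hyK⟩ ⟨z, hz, hzL⟩⟩)
  simp only [notMem_compl_iff] at hβ1
  have hβS : ∀ x, x ∈ S ↔ β x ∈ S := fun x =>
    ⟨fun hx => by rwa [hβ1 x hx], fun hx => by rwa [← β.injective (hβ1 _ hx)]⟩
  let F : 𝒞 → Set X := fun K => {x | (B.cls x ∩ β ⁻¹' K).Nonempty}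
  have hKc : ∀ K : 𝒞, IsClosed (K : Set X) :=
    fun K => (A.isCompact' K (h𝒞A K K.2).1).isClosed
  have hFc : ∀ K, IsClosed (F K) := by
    intro K
    have := hB.vanishing.isOpen_core ((hKc K).preimage β.continuous).isOpen_compl
    rw [← isOpen_compl_iff]
    convert this using 1
    ext x
    simp only [F, mem_compl_iff, mem_ofPred_eq, not_nonempty_iff_eq_empty, subset_compl_iff_disjoint_right,
      disjoint_iff_inter_eq_empty]
  have hFu : LocallyUnique F := by
    intro x
    let s : Set 𝒞 := {K | ¬ (B.cls x ∩ β ⁻¹' K).Nonempty}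
    have hO : IsOpen (⋃ K ∈ s, (K : Set X))ᶜ := (h𝒞.isClosed_biUnion hKc s).isOpen_compl
    have hmem : ∀ K : 𝒞, ({y | B.cls y ⊆ β ⁻¹' (⋃ K ∈ s, (K : Set X))ᶜ} ∩ F K).Nonempty →
        (B.cls x ∩ β ⁻¹' K).Nonempty := by
      rintro K ⟨y, hy, z, hz, hzK⟩
      by_contra hK
      exact hy hz (mem_iUnion₂.2 ⟨K, hK, hzK⟩)
    refine ⟨_, hB.vanishing.isOpen_core (hO.preimage β.continuous), ?_, fun K L hK hL => ?_⟩
    · intro y hy hy'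
      obtain ⟨K, hK, hyK⟩ := mem_iUnion₂.1 hy'
      exact hK ⟨y, hy, hyK⟩
    · obtain ⟨y, hy, hyK⟩ := hmem K hK
      obtain ⟨z, hz, hzL⟩ := hmem L hL
      have hyS : y ∈ Sᶜ := fun h => (h𝒞A K K.2).2.1 hyK ((hβS y).1 h)
      have hcl : B.cls x ⊆ Sᶜ := by
        rw [← cls_eq (B.cls_mem x) hy]; exact hS.symm.cls_subset_compl y hyS
      exact hβ3 _ (B.cls_mem x) hcl y hy z hz K L hyK hzL
  let O : 𝒞 → Set X := fun K => (⋃ k ∈ (K : Set X), {x | τ k x < 2 * ε}) ∩ Sᶜ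
  have hO : ∀ K, IsOpen (O K) := fun K =>
    (isOpen_biUnion fun k _ => hτ.isOpen_ball k _).inter hS.isClosed.isOpen_compl
  have hFO : ∀ K, F K ⊆ O K := by
    rintro K x ⟨y, hy, hyK⟩
    have hyS : y ∈ Sᶜ := fun h => (h𝒞A K K.2).2.1 hyK ((hβS y).1 h)
    have hcl : B.cls x ⊆ Sᶜ := by
      rw [← cls_eq (B.cls_mem x) hy]; exact hS.symm.cls_subset_compl y hyS
    refine ⟨mem_iUnion₂.2 ⟨β y, hyK, ?_⟩, hcl (B.mem_cls x)⟩
    have h1 := hBτ _ (B.cls_mem x) hcl y hy x (B.mem_cls x)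
    have h2 := hβ2 y hyS
    have h3 := hτ.tri (β y) y x
    rw [mem_ofPred_eq]
    linarith
  have hOd : ∀ K, ∀ x ∈ O K, ∀ y ∈ O K, τ x y < 5 * ε := by
    rintro K x ⟨hx, -⟩ y ⟨hy, -⟩
    obtain ⟨k, hk, hkx⟩ := mem_iUnion₂.1 hx
    obtain ⟨l, hl, hly⟩ := mem_iUnion₂.1 hy
    rw [mem_ofPred_eq] at hkx hly
    have h1 := hAτ K (h𝒞A K K.2).1 (h𝒞A K K.2).2.1 k hk l hl
    have h2 := hτ.tri x k y
    have h3 := hτ.tri k l y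
    rw [hτ.symm x k] at h2
    linarith
  obtain ⟨W, hWu, hW⟩ := hFu.exists_open_expansion hFc hO hFO
  have hKF : ∀ K : 𝒞, β.symm '' (K : Set X) ⊆ F K := by
    rintro K _ ⟨k, hk, rfl⟩
    exact ⟨β.symm k, B.mem_cls _, by rwa [mem_preimage, β.apply_symm_apply]⟩
  have hg : ∀ K : 𝒞, ∃ g : X ≃ₜ X, (∀ z ∉ W K, g z = z) ∧ g '' (β.symm '' K) ∈ B.pieces := by
    intro K
    obtain ⟨k, hk⟩ := A.nonempty' K (h𝒞A K K.2).1
    refine hB.exists_image_mem h𝒦 hX (hW K).1 (h𝒦.2.1 β.symm K (h𝒞A K K.2).2.2)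
      ((hKF K).trans (hW K).2.1) (mem_image_of_mem _ hk) fun y hy => (hW K).2.1 ?_
    change (B.cls y ∩ _).Nonempty
    rw [cls_eq (B.cls_mem _) hy]
    exact hKF K (mem_image_of_mem _ hk)
  choose g hgW hgK using hg
  obtain ⟨G, hG1, hG2⟩ := hWu.exists_glued_homeomorph g hgW
  have hWS : ∀ x ∈ S, ∀ K, x ∉ W K := fun x hx K hxK => ((hW K).2.2 hxK).2 hx
  refine ⟨β.symm.trans G, fun x hx => ?_, fun x => ?_, fun K hK => ?_⟩
  · rw [Homeomorph.trans_apply, β.symm_apply_eq.2 (hβ1 x hx).symm, hG2 x (hWS x hx)]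
  · obtain ⟨y, rfl⟩ := β.surjective x
    rw [Homeomorph.trans_apply, β.symm_apply_apply]
    have h1 : τ y (β y) ≤ ε := by
      by_cases hy : y ∈ S
      · rw [hβ1 y hy, hτ.refl]; exact hε.le
      · rw [hτ.symm]; exact (hβ2 y hy).le
    have h2 : τ (G y) y ≤ 5 * ε := by
      by_cases hy : ∃ K, y ∈ W K
      · obtain ⟨K, hK⟩ := hy
        rw [hG1 K y hK]
        exact (hOd K _ ((hW K).2.2 (Homeomorph.mem_of_support (hgW K) hK)) _ ((hW K).2.2 hK)).le
      · rw [hG2 y (fun K hK => hy ⟨K, hK⟩), hτ.refl]; positivity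
    linarith [hτ.tri (G y) y (β y)]
  · have := hgK ⟨K, hK⟩
    rwa [← image_congr fun x hx => hG1 ⟨K, hK⟩ x ((hW _).2.1 (hKF _ hx)), ← image_comp] at this

/-- The pieces of `A` and `B` can be made simultaneously small. -/
lemma IsGood.exists_shrinking (hA : A.IsGood 𝒦) (hB : B.IsGood 𝒦) {S : Set X}
    (hS : A.MatchedOn B S) {τ d₁ d₂ : X → X → ℝ}
    (hτ : IsContPseudometric τ) (hd₁ : IsContPseudometric d₁) (hd₂ : IsContPseudometric d₂)
    {ε ε' : ℝ} (hε : 0 < ε) (hε' : 0 < ε')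
    (hAτ : ∀ K ∈ A.pieces, K ⊆ Sᶜ → IsSmall τ ε K ∧ IsSmall d₁ ε' K)
    (hBτ : ∀ K ∈ B.pieces, K ⊆ Sᶜ → IsSmall τ ε K) :
    ∃ γ : X ≃ₜ X, (∀ x ∈ S, γ x = x) ∧ (∀ x, τ (γ x) x ≤ 2 * ε) ∧
      (∀ K ∈ A.pieces, K ⊆ Sᶜ → IsSmall (fun x y => d₂ (γ x) (γ y)) ε' K) ∧
      ∀ K ∈ (B.comap γ).pieces, K ⊆ Sᶜ → IsSmall d₁ (3 * ε') K := by
  obtain ⟨β, hβ1, hβ2, hβ3⟩ := hB.shrinksIn Sᶜ hS.isClosed.isOpen_compl hS.symm.cls_subset_compl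
    (fun x y => τ x y < ε) (fun x y => d₁ x y < ε')
    (fun K hK hKS => hτ.exists_isOpen_of_isCompact (B.isCompact' K hK) (hBτ K hK hKS))
    (fun x _ => hd₁.exists_isOpen_of_pos x hε')
  obtain ⟨α, hα1, hα2, hα3⟩ := hA.shrinksIn Sᶜ hS.isClosed.isOpen_compl hS.cls_subset_compl
    (fun x y => τ x y < ε ∧ d₁ x y < ε') (fun x y => d₂ (β.symm x) (β.symm y) < ε')
    (fun K hK hKS => by
      obtain ⟨O, hO, hKO, h1⟩ :=
        hτ.exists_isOpen_of_isCompact (A.isCompact' K hK) (hAτ K hK hKS).1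
      obtain ⟨P, hP, hKP, h2⟩ :=
        hd₁.exists_isOpen_of_isCompact (A.isCompact' K hK) (hAτ K hK hKS).2
      exact ⟨O ∩ P, hO.inter hP, subset_inter hKO hKP,
        fun x hx y hy => ⟨h1 x hx.1 y hy.1, h2 x hx.2 y hy.2⟩⟩)
    (fun x _ => (hd₂.comp β.symm.continuous).exists_isOpen_of_pos x hε')
  simp only [notMem_compl_iff] at hα1 hβ1
  have hid : ∀ x ∈ S, (α.trans β.symm) x = x := fun x hx => by
    rw [Homeomorph.trans_apply, hα1 x hx, β.symm_apply_eq, hβ1 x hx]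
  refine ⟨α.trans β.symm, hid, fun x => ?_, fun K hK hKS => hα3 K hK hKS,
    fun K hK hKS x hx y hy => ?_⟩
  · by_cases hx : x ∈ S
    · rw [hid x hx, hτ.refl]; positivity
    · have hy : β.symm (α x) ∉ S := fun h => hx (by
        have h' := hid _ h
        rw [← show (α.trans β.symm) x = β.symm (α x) from rfl] at h' h
        rwa [← (α.trans β.symm).injective h'])
      have h1 := hβ2 _ hy
      rw [β.apply_symm_apply] at h1
      have h2 := (hα2 x hx).1
      have h3 := hτ.tri (β.symm (α x)) (α x) x
      rw [hτ.symm (α x)] at h1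
      rw [Homeomorph.trans_apply]
      linarith
  · have hKS' : (α.trans β.symm) '' K ⊆ Sᶜ := by
      rintro _ ⟨z, hz, rfl⟩ h
      have h' := hid _ h
      exact hKS hz (by rwa [(α.trans β.symm).injective h'] at h)
    have h1 : d₁ (α x) (α y) < ε' := by
      have := hβ3 _ hK hKS' _ (mem_image_of_mem _ hx) _ (mem_image_of_mem _ hy)
      simpa using this
    have h2 := (hα2 x (hKS hx)).2
    have h3 := (hα2 y (hKS hy)).2
    have h4 := hd₁.tri x (α x) y
    have h5 := hd₁.tri (α x) (α y) y
    rw [hd₁.symm x (α x)] at h4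
    linarith

end Steps

end Decomposition

namespace Decomposition

section OneStep

variable {X : Type*}

lemma eq_of_pieces_eq [TopologicalSpace X] {A B : Decomposition X} (h : A.pieces = B.pieces) :
    A = B := by
  cases A; cases B; congr

lemma comap_comap [TopologicalSpace X] (D : Decomposition X) (Φ γ : X ≃ₜ X) :
    (D.comap Φ).comap γ = D.comap (γ.trans Φ) := by
  refine eq_of_pieces_eq (Set.ext fun K => ?_)
  rw [mem_comap_pieces, mem_comap_pieces, mem_comap_pieces, ← image_comp]
  rfl

lemma MatchedOn.comap [TopologicalSpace X] {A B : Decomposition X} {S : Set X}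
    (h : A.MatchedOn B S) {γ : X ≃ₜ X} (hγ : ∀ x ∈ S, γ x = x) : A.MatchedOn (B.comap γ) S where
  isClosed := h.isClosed
  mem K hK hn := by
    obtain ⟨h1, h2⟩ := h.mem K hK hn
    refine ⟨h1, ?_⟩
    rw [mem_comap_pieces, image_congr fun x hx => hγ x (h1 hx), image_id']
    exact h2

/-- The pieces of `D` disjoint from `S` whose diameter with respect to `d` is at least `ε`. -/
def largePieces [TopologicalSpace X] (D : Decomposition X) (S : Set X) (d : X → X → ℝ) (ε : ℝ) :
    Set (Set X) :=
  {K | K ∈ D.pieces ∧ K ⊆ Sᶜ ∧ ¬ IsSmall d ε K}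

lemma IsGood.locallyUnique_largePieces [MetricSpace X] {D : Decomposition X} {𝒦 : Set (Set X)}
    (hD : D.IsGood 𝒦) (S : Set X) {d : X → X → ℝ} (hd : IsContPseudometric d) {ε : ℝ}
    (hε : 0 < ε) : LocallyUnique fun K : D.largePieces S d ε => (K : Set X) := by
  intro x
  obtain ⟨V, hV, hxV, h⟩ := hD.vanishing.locally_unique hd hε x
  exact ⟨V, hV, hxV, fun K L hK hL =>
    Subtype.ext (h K K.2.1 K.2.2.2 L L.2.1 L.2.2.2 hK hL)⟩

lemma IsGood.mem_of_mem_largePieces [TopologicalSpace X] {D : Decomposition X} {𝒦 : Set (Set X)}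
    (hD : D.IsGood 𝒦) {S : Set X} {d : X → X → ℝ} (hd : IsContPseudometric d) {ε : ℝ}
    (hε : 0 < ε) {K : Set X} (hK : K ∈ D.largePieces S d ε) : K ∈ 𝒦 :=
  hD.mem K hK.1 fun hs => hK.2.2 fun y hy z hz => by rwa [hs hy hz, hd.refl]

lemma _root_.LocallyUnique.image [TopologicalSpace X] {𝒞 : Set (Set X)}
    (h : LocallyUnique fun K : 𝒞 => (K : Set X)) (γ : X ≃ₜ X) :
    LocallyUnique fun K : ((fun K : Set X => γ '' K) '' 𝒞 : Set (Set X)) => (K : Set X) := by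
  intro x
  obtain ⟨V, hV, hxV, hV'⟩ := h (γ.symm x)
  refine ⟨γ.symm ⁻¹' V, hV.preimage γ.symm.continuous, hxV, ?_⟩
  rintro ⟨_, K, hK, rfl⟩ ⟨_, L, hL, rfl⟩ ⟨_, hy, y, hyK, rfl⟩ ⟨_, hz, z, hzL, rfl⟩
  rw [mem_preimage, γ.symm_apply_apply] at hy hz
  have := hV' ⟨K, hK⟩ ⟨L, hL⟩ ⟨y, hy, hyK⟩ ⟨z, hz, hzL⟩
  rw [Subtype.mk.injEq] at this
  subst this
  rfl

lemma _root_.Homeomorph.image_subset_compl [TopologicalSpace X] {γ : X ≃ₜ X} {S N : Set X}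
    (hγ : ∀ x ∈ S, γ x = x) (hN : N ⊆ Sᶜ) : γ '' N ⊆ Sᶜ := by
  rintro _ ⟨x, hx, rfl⟩ h
  exact hN hx (by rwa [γ.injective (hγ _ h)] at h)

lemma _root_.IsContPseudometric.isSmall_of_image [TopologicalSpace X] {τ : X → X → ℝ}
    (hτ : IsContPseudometric τ) {γ : X → X} {c ε ε' : ℝ} (hγ : ∀ x, τ (γ x) x ≤ c) {N : Set X}
    (hN : IsSmall τ ε (γ '' N)) (hε : ε + 2 * c ≤ ε') : IsSmall τ ε' N := by
  intro x hx y hy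
  have h1 := hN _ (mem_image_of_mem γ hx) _ (mem_image_of_mem γ hy)
  have h2 := hτ.tri x (γ x) y
  have h3 := hτ.tri (γ x) (γ y) y
  rw [hτ.symm x (γ x)] at h2
  linarith [hγ x, hγ y]

/-- One step of the back-and-forth construction: large pieces are matched, all the other pieces
are made small. -/
lemma IsGood.exists_step [MetricSpace X] {A B : Decomposition X} {𝒦 : Set (Set X)}
    (hA : A.IsGood 𝒦) (hB : B.IsGood 𝒦) (h𝒦 : IsTameFamily 𝒦)
    (hX : StronglyLocallyHomogeneous X) {S : Set X} (hS : A.MatchedOn B S)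
    {τ d₁ d₂ : X → X → ℝ} (hτ : IsContPseudometric τ) (hd₁ : IsContPseudometric d₁)
    (hd₂ : IsContPseudometric d₂) {ε ε' : ℝ} (hε : 0 < ε) (hε' : 0 < ε')
    (hAτ : ∀ K ∈ A.pieces, K ⊆ Sᶜ → IsSmall τ ε K) (hBτ : ∀ K ∈ B.pieces, K ⊆ Sᶜ → IsSmall τ ε K) :
    ∃ (γ : X ≃ₜ X) (S' : Set X), S ⊆ S' ∧ A.MatchedOn (B.comap γ) S' ∧ (∀ x ∈ S, γ x = x) ∧
      (∀ x, τ (γ x) x ≤ 422 * ε) ∧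
      (∀ K ∈ A.pieces, K ⊆ S'ᶜ → IsSmall (fun x y => d₁ x y + d₂ (γ x) (γ y)) (4 * ε') K) ∧
      ∀ K ∈ (B.comap γ).pieces, K ⊆ S'ᶜ →
        IsSmall (fun x y => d₁ x y + d₂ (γ x) (γ y)) (4 * ε') K := by
  have h𝒞₁ := hA.locallyUnique_largePieces S hd₁ hε'
  obtain ⟨γ₁, hγ₁S, hγ₁τ, hγ₁⟩ := hB.exists_matching h𝒦 hX hS hτ hε hAτ hBτ h𝒞₁
    fun K hK => ⟨hK.1, hK.2.1, hA.mem_of_mem_largePieces hd₁ hε' hK⟩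
  have hB₁ := hB.comap h𝒦.2.1 γ₁
  set B₁ := B.comap γ₁ with hB₁def
  set S₁ := S ∪ ⋃₀ A.largePieces S d₁ ε' with hS₁def
  have hS₁ : A.MatchedOn B₁ S₁ := (hS.comap hγ₁S).union h𝒞₁ fun K hK =>
    ⟨(A.isCompact' K hK.1).isClosed, hK.1, hγ₁ K hK⟩
  have hSS₁ : S ⊆ S₁ := subset_union_left
  have hB₁τ : ∀ K ∈ B₁.pieces, K ⊆ S₁ᶜ → IsSmall τ (13 * ε) K := fun K hK hKS =>
    hτ.isSmall_of_image hγ₁τ (hBτ _ hK (Homeomorph.image_subset_compl hγ₁S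
      (hKS.trans (compl_subset_compl.2 hSS₁)))) (by linarith)
  have hd₂' := hd₂.comp γ₁.continuous
  have h𝒞₂ := hB₁.locallyUnique_largePieces S₁ hd₂' hε'
  obtain ⟨γ₂, hγ₂S, hγ₂τ, hγ₂⟩ := hA.exists_matching h𝒦 hX hS₁.symm hτ (ε := 13 * ε)
    (by positivity) hB₁τ (fun K hK hKS x hx y hy => by
      have := hAτ K hK (hKS.trans (compl_subset_compl.2 hSS₁)) x hx y hy
      linarith) h𝒞₂
    fun K hK => ⟨hK.1, hK.2.1, hB₁.mem_of_mem_largePieces hd₂' hε' hK⟩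
  have hγ₂S' : ∀ x ∈ S₁, γ₂.symm x = x := fun x hx => by rw [γ₂.symm_apply_eq, hγ₂S x hx]
  set S₂ := S₁ ∪ ⋃₀ ((fun K : Set X => γ₂ '' K) '' B₁.largePieces S₁
    (fun x y => d₂ (γ₁ x) (γ₁ y)) ε') with hS₂def
  have hS₁S₂ : S₁ ⊆ S₂ := subset_union_left
  have hS₂ : A.MatchedOn (B₁.comap γ₂.symm) S₂ := by
    refine (hS₁.comap hγ₂S').union (h𝒞₂.image γ₂) ?_
    rintro _ ⟨K, hK, rfl⟩
    refine ⟨(A.isCompact' _ (hγ₂ K hK)).isClosed, hγ₂ K hK, ?_⟩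
    rw [mem_comap_pieces, ← image_comp, γ₂.symm_comp_self, image_id]
    exact hK.1
  have hB₂ : B₁.comap γ₂.symm = B.comap (γ₂.symm.trans γ₁) := comap_comap _ _ _
  have hδS : ∀ x ∈ S, (γ₂.symm.trans γ₁) x = x := fun x hx => by
    rw [Homeomorph.trans_apply, hγ₂S' x (hSS₁ hx), hγ₁S x hx]
  have hδτ : ∀ x, τ ((γ₂.symm.trans γ₁) x) x ≤ 84 * ε := by
    intro x
    obtain ⟨y, rfl⟩ := γ₂.surjective x
    rw [Homeomorph.trans_apply, γ₂.symm_apply_apply]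
    have h1 := hγ₂τ y
    have h2 := hγ₁τ y
    have h3 := hτ.tri (γ₁ y) y (γ₂ y)
    rw [hτ.symm y] at h3
    linarith
  have hB₂d : ∀ K ∈ (B₁.comap γ₂.symm).pieces, K ⊆ S₂ᶜ →
      IsSmall (fun x y => d₂ ((γ₂.symm.trans γ₁) x) ((γ₂.symm.trans γ₁) y)) ε' K := by
    intro K hK hKS
    by_contra hn
    obtain ⟨z, hz⟩ := (B₁.comap γ₂.symm).nonempty' K hK
    refine hKS hz (Or.inr (mem_sUnion.2 ⟨K, ⟨γ₂.symm '' K, ⟨hK,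
      Homeomorph.image_subset_compl hγ₂S' (hKS.trans (compl_subset_compl.2 hS₁S₂)), ?_⟩, ?_⟩, hz⟩))
    · exact fun h => hn fun x hx y hy => h _ (mem_image_of_mem _ hx) _ (mem_image_of_mem _ hy)
    · change γ₂ '' (γ₂.symm '' K) = K
      rw [← image_comp, γ₂.self_comp_symm, image_id]
  obtain ⟨γ₃, hγ₃S, hγ₃τ, hγ₃A, hγ₃B⟩ := hA.exists_shrinking (hB₁.comap h𝒦.2.1 γ₂.symm) hS₂ hτ hd₁
    (hd₂.comp (γ₂.symm.trans γ₁).continuous) (ε := 169 * ε) (by positivity) hε'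
    (fun K hK hKS => by
      have hKS₁ := hKS.trans (compl_subset_compl.2 hS₁S₂)
      have hKS₀ := hKS₁.trans (compl_subset_compl.2 hSS₁)
      refine ⟨fun x hx y hy => by linarith [hAτ K hK hKS₀ x hx y hy], ?_⟩
      by_contra hn
      obtain ⟨z, hz⟩ := A.nonempty' K hK
      exact hKS₁ hz (Or.inr (mem_sUnion.2 ⟨K, ⟨hK, hKS₀, hn⟩, hz⟩)))
    (fun K hK hKS => by
      rw [hB₂] at hK
      exact hτ.isSmall_of_image hδτ (hBτ _ hK (Homeomorph.image_subset_compl hδS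
        (hKS.trans (compl_subset_compl.2 (hSS₁.trans hS₁S₂))))) (by linarith))
  have hB₃ : (B₁.comap γ₂.symm).comap γ₃ = B.comap (γ₃.trans (γ₂.symm.trans γ₁)) := by
    rw [hB₂, comap_comap]
  refine ⟨γ₃.trans (γ₂.symm.trans γ₁), S₂, hSS₁.trans hS₁S₂, ?_, fun x hx => ?_, fun x => ?_,
    fun K hK hKS x hx y hy => ?_, fun K hK hKS x hx y hy => ?_⟩
  · rw [← hB₃]
    exact hS₂.comap hγ₃S
  · rw [Homeomorph.trans_apply, hγ₃S x (hS₁S₂ (hSS₁ hx)), hδS x hx]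
  · have h1 := hδτ (γ₃ x)
    have h2 := hγ₃τ x
    have h3 := hτ.tri ((γ₂.symm.trans γ₁) (γ₃ x)) (γ₃ x) x
    rw [Homeomorph.trans_apply]
    linarith
  · have h1 := hγ₃A K hK hKS x hx y hy
    have h2 : d₁ x y < ε' := by
      have hKS₁ := hKS.trans (compl_subset_compl.2 hS₁S₂)
      by_contra hn
      exact hKS₁ hx (Or.inr (mem_sUnion.2 ⟨K, ⟨hK, hKS₁.trans (compl_subset_compl.2 hSS₁),
        fun h => hn (h x hx y hy)⟩, hx⟩))
    change d₁ x y + d₂ ((γ₂.symm.trans γ₁) (γ₃ x)) ((γ₂.symm.trans γ₁) (γ₃ y)) < 4 * ε'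
    linarith
  · rw [← hB₃] at hK
    have h1 := hγ₃B K hK hKS x hx y hy
    have h2 := hB₂d _ hK (Homeomorph.image_subset_compl hγ₃S hKS) _ (mem_image_of_mem _ hx) _
      (mem_image_of_mem _ hy)
    change d₁ x y + d₂ ((γ₂.symm.trans γ₁) (γ₃ x)) ((γ₂.symm.trans γ₁) (γ₃ y)) < 4 * ε'
    linarith

end OneStep

section Limit

variable {X : Type*} [MetricSpace X]

lemma _root_.Homeomorph.exists_limit [CompleteSpace X] (Φ : ℕ → X ≃ₜ X) {C : ℝ}
    (h : ∀ n x, dist (Φ n x) (Φ (n + 1) x) ≤ C / 2 / 2 ^ n)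
    (h' : ∀ n x, dist ((Φ n).symm x) ((Φ (n + 1)).symm x) ≤ C / 2 / 2 ^ n) :
    ∃ Ψ : X ≃ₜ X, ∀ x, Filter.Tendsto (fun n => Φ n x) Filter.atTop (𝓝 (Ψ x)) := by
  have h0 : Filter.Tendsto (fun n : ℕ => C / 2 ^ n) Filter.atTop (𝓝 0) := by
    have := (tendsto_pow_atTop_nhds_zero_of_lt_one (r := (1 / 2 : ℝ)) (by norm_num)
      (by norm_num)).const_mul C
    simpa [div_eq_mul_inv] using this
  obtain ⟨f, hf, hlf, hdf⟩ := exists_continuous_limit (fun n => (Φ n).continuous) h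
  obtain ⟨g, hg, hlg, hdg⟩ := exists_continuous_limit (fun n => (Φ n).symm.continuous) h'
  refine ⟨{ toFun := f
            invFun := g
            left_inv := fun x => ?_
            right_inv := fun y => ?_
            continuous_toFun := hf
            continuous_invFun := hg }, hlf⟩
  · refine tendsto_nhds_unique ((hg.tendsto _).comp (hlf x)) ?_
    refine (tendsto_const_nhds (x := x)).congr_dist (squeeze_zero (fun _ => dist_nonneg)
      (fun n => ?_) h0)
    have := hdg n (Φ n x)
    rwa [(Φ n).symm_apply_apply] at this
  · refine tendsto_nhds_unique ((hf.tendsto _).comp (hlg y)) ?_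
    refine (tendsto_const_nhds (x := y)).congr_dist (squeeze_zero (fun _ => dist_nonneg)
      (fun n => ?_) h0)
    have := hdf n ((Φ n).symm y)
    rwa [(Φ n).apply_symm_apply] at this

/-- A homeomorphism which almost matches two good decompositions is close to one which carries the
first decomposition to the second. -/
theorem IsGood.exists_homeomorph [CompleteSpace X] {A B : Decomposition X} {𝒦 : Set (Set X)}
    (hA : A.IsGood 𝒦) (hB : B.IsGood 𝒦) (h𝒦 : IsTameFamily 𝒦)
    (hX : StronglyLocallyHomogeneous X) {d : X → X → ℝ} (hd : IsContPseudometric d)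
    (hdist : ∀ x y, dist x y ≤ d x y) {η : ℝ} (hη : 0 < η) {Φ₀ : X ≃ₜ X} {S₀ : Set X}
    (hS₀ : A.MatchedOn (B.comap Φ₀) S₀)
    (hA₀ : ∀ K ∈ A.pieces, K ⊆ S₀ᶜ →
      IsSmall (fun x y => d x y + d (Φ₀ x) (Φ₀ y)) (4 * (η / 3376)) K)
    (hB₀ : ∀ K ∈ (B.comap Φ₀).pieces, K ⊆ S₀ᶜ →
      IsSmall (fun x y => d x y + d (Φ₀ x) (Φ₀ y)) (4 * (η / 3376)) K) :
    ∃ Φ : X ≃ₜ X, (∀ x, d (Φ₀ x) (Φ x) ≤ η) ∧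
      ∀ x y, A.cls x = A.cls y ↔ B.cls (Φ x) = B.cls (Φ y) := by
  let e : ℕ → ℝ := fun n => η / 3376 / 2 ^ n
  have he : ∀ n, 0 < e n := fun n => by positivity
  have he' : ∀ n, 422 * (4 * e n) = η / 2 / 2 ^ n := fun n => by
    simp only [e]
    ring
  let P : ℕ → (X ≃ₜ X) × Set X → Prop := fun n s =>
    A.MatchedOn (B.comap s.1) s.2 ∧
    (∀ K ∈ A.pieces, K ⊆ s.2ᶜ → IsSmall (fun x y => d x y + d (s.1 x) (s.1 y)) (4 * e n) K) ∧
    ∀ K ∈ (B.comap s.1).pieces, K ⊆ s.2ᶜ →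
      IsSmall (fun x y => d x y + d (s.1 x) (s.1 y)) (4 * e n) K
  have hstep : ∀ (n : ℕ) (s : {s // P n s}), ∃ s' : {s // P (n + 1) s}, s.1.2 ⊆ s'.1.2 ∧
      (∀ x ∈ s.1.2, s'.1.1 x = s.1.1 x) ∧ (∀ x, d (s.1.1 x) (s'.1.1 x) ≤ η / 2 / 2 ^ n) ∧
      ∀ x, d (s.1.1.symm x) (s'.1.1.symm x) ≤ η / 2 / 2 ^ n := by
    rintro n ⟨⟨Φ, S⟩, h1, h2, h3⟩
    obtain ⟨γ, S', hSS', hm, hid, hmove, hsA, hsB⟩ := hA.exists_step (hB.comap h𝒦.2.1 Φ) h𝒦 hX h1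
      (hd.add (hd.comp Φ.continuous)) hd (hd.comp Φ.continuous) (ε := 4 * e n)
      (by linarith [he n]) (he (n + 1)) h2 h3
    rw [comap_comap] at hm hsB
    have hmove' : ∀ x, d (γ x) x ≤ η / 2 / 2 ^ n ∧ d (Φ (γ x)) (Φ x) ≤ η / 2 / 2 ^ n := by
      intro x
      have h4 := hmove x
      rw [he'] at h4
      have h5 := hd.nonneg (γ x) x
      have h6 := hd.nonneg (Φ (γ x)) (Φ x)
      constructor <;> linarith
    refine ⟨⟨⟨γ.trans Φ, S'⟩, hm, hsA, hsB⟩, hSS', fun x hx => ?_, fun x => ?_, fun x => ?_⟩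
    · change Φ (γ x) = Φ x
      rw [hid x hx]
    · rw [hd.symm]
      exact (hmove' x).2
    · change d (Φ.symm x) (γ.symm (Φ.symm x)) ≤ _
      have := (hmove' (γ.symm (Φ.symm x))).1
      rwa [γ.apply_symm_apply] at this
  choose next hn1 hn2 hn3 hn4 using hstep
  let s : (n : ℕ) → {s // P n s} := fun n =>
    Nat.rec ⟨⟨Φ₀, S₀⟩, hS₀, by simpa [e] using hA₀, by simpa [e] using hB₀⟩ next n
  let Φ : ℕ → X ≃ₜ X := fun n => (s n).1.1
  let S : ℕ → Set X := fun n => (s n).1.2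
  have hmono : Monotone S := monotone_nat_of_le_succ fun n => hn1 n (s n)
  have hΦ : ∀ n x, d (Φ n x) (Φ (n + 1) x) ≤ η / 2 / 2 ^ n := fun n => hn3 n (s n)
  have hΦ' : ∀ n x, d ((Φ n).symm x) ((Φ (n + 1)).symm x) ≤ η / 2 / 2 ^ n := fun n => hn4 n (s n)
  obtain ⟨Ψ, hΨ⟩ := Homeomorph.exists_limit Φ (fun n x => (hdist _ _).trans (hΦ n x))
    (fun n x => (hdist _ _).trans (hΦ' n x))
  have hconst : ∀ n, ∀ x ∈ S n, Ψ x = Φ n x := by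
    intro n x hx
    refine tendsto_nhds_unique (hΨ x) (tendsto_const_nhds.congr' ?_)
    filter_upwards [Filter.eventually_ge_atTop n] with m hm
    induction m, hm using Nat.le_induction with
    | base => rfl
    | succ m hm ih => rw [ih]; exact (hn2 m (s m) x (hmono hm hx)).symm
  have hsub : ∀ K : Set X, (∀ n, IsSmall dist (4 * e n) K) → K.Subsingleton := by
    intro K hK x hx y hy
    refine dist_le_zero.1 (le_of_forall_pos_lt_add fun r hr => ?_)
    obtain ⟨n, hn⟩ := exists_div_two_pow_lt (η / 3376) (r := r / 4) (by positivity)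
    have := hK n x hx y hy
    simp only [e] at this
    linarith
  have hAB : ∀ K ∈ A.pieces, ¬ K.Subsingleton → Ψ '' K ∈ B.pieces := by
    intro K hK hKn
    by_contra hnot
    refine hKn (hsub K fun n x hx y hy => ?_)
    rcases (s n).2.1.subset_or hK with ⟨h1, h2⟩ | h1
    · refine (hnot ?_).elim
      rw [image_congr fun x hx => hconst n x (h1 hx)]
      exact h2
    · have := (s n).2.2.1 K hK h1 x hx y hy
      linarith [hdist x y, hd.nonneg ((s n).1.1 x) ((s n).1.1 y)]
  have hBA : ∀ L ∈ B.pieces, ¬ L.Subsingleton → ∃ K ∈ A.pieces, Ψ '' K = L := by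
    intro L hL hLn
    by_contra hnot
    refine hLn (hsub L fun n x hx y hy => ?_)
    have hK : Φ n ⁻¹' L ∈ (B.comap (Φ n)).pieces := preimage_mem_comap_pieces.2 hL
    rcases (s n).2.1.symm.subset_or hK with ⟨h1, h2⟩ | h1
    · refine (hnot ⟨_, h2, ?_⟩).elim
      rw [image_congr fun x hx => hconst n x (h1 hx), (Φ n).image_preimage]
    · have := (s n).2.2.2 _ hK h1 ((Φ n).symm x)
        (by rwa [mem_preimage, (Φ n).apply_symm_apply]) ((Φ n).symm y)
        (by rwa [mem_preimage, (Φ n).apply_symm_apply])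
      change d ((Φ n).symm x) ((Φ n).symm y) +
        d (Φ n ((Φ n).symm x)) (Φ n ((Φ n).symm y)) < 4 * e n at this
      rw [(Φ n).apply_symm_apply, (Φ n).apply_symm_apply] at this
      linarith [hdist x y, hd.nonneg ((Φ n).symm x) ((Φ n).symm y)]
  refine ⟨Ψ, fun x => ?_, fun x y => ⟨fun h => ?_, fun h => ?_⟩⟩
  · refine le_of_tendsto (((hd.continuous_right (Φ₀ x)).tendsto _).comp (hΨ x))
      (Filter.Eventually.of_forall fun n => ?_)
    have := hd.le_of_step (s := fun n => Φ n x) hη.le (fun n => hΦ n x) (Nat.zero_le n)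
    rwa [pow_zero, div_one] at this
  · by_cases hs : (A.cls x).Subsingleton
    · rw [hs (A.mem_cls x) (h ▸ A.mem_cls y)]
    · have hp := hAB _ (A.cls_mem x) hs
      rw [cls_eq hp (mem_image_of_mem _ (A.mem_cls x)),
        cls_eq hp (mem_image_of_mem _ (h ▸ A.mem_cls y))]
  · by_cases hs : (B.cls (Ψ x)).Subsingleton
    · rw [Ψ.injective (hs (B.mem_cls (Ψ x)) (h ▸ B.mem_cls (Ψ y)))]
    · obtain ⟨K, hK, hKL⟩ := hBA _ (B.cls_mem (Ψ x)) hs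
      have key : ∀ z, Ψ z ∈ B.cls (Ψ x) → z ∈ K := by
        intro z hz
        rw [← hKL] at hz
        exact (Ψ.injective.mem_set_image).1 hz
      rw [cls_eq hK (key x (B.mem_cls _)), cls_eq hK (key y (h ▸ B.mem_cls (Ψ y)))]

lemma exists_liftable {X : Type*} [TopologicalSpace X] {A B : Decomposition X} (Φ : X ≃ₜ X)
    (h : ∀ x y, A.cls x = A.cls y ↔ B.cls (Φ x) = B.cls (Φ y)) :
    ∃ φ : A.Space ≃ₜ B.Space, ∀ x, B.q (Φ x) = φ (A.q x) := by
  choose a ha using A.q_surjective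
  choose b hb using B.q_surjective
  have h1 : ∀ x, B.q (Φ (a (A.q x))) = B.q (Φ x) := fun x =>
    B.q_eq_iff.2 ((h _ _).1 (A.q_eq_iff.1 (ha (A.q x))))
  have h2 : ∀ y, A.q (Φ.symm (b (B.q y))) = A.q (Φ.symm y) := fun y =>
    A.q_eq_iff.2 ((h _ _).2 (by
      rw [Φ.apply_symm_apply, Φ.apply_symm_apply]; exact B.q_eq_iff.1 (hb (B.q y))))
  refine ⟨{ toFun := fun p => B.q (Φ (a p)), invFun := fun p => A.q (Φ.symm (b p))
            left_inv := fun p => ?_, right_inv := fun p => ?_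
            continuous_toFun := ?_, continuous_invFun := ?_ }, fun x => (h1 x).symm⟩
  · change A.q (Φ.symm (b (B.q (Φ (a p))))) = p
    rw [h2, Φ.symm_apply_apply, ha]
  · change B.q (Φ (a (A.q (Φ.symm (b p))))) = p
    rw [h1, Φ.apply_symm_apply, hb]
  · rw [A.isQuotientMap_q.continuous_iff]
    exact (B.continuous_q.comp Φ.continuous).congr fun x => (h1 x).symm
  · rw [B.isQuotientMap_q.continuous_iff]
    exact (A.continuous_q.comp Φ.symm.continuous).congr fun x => (h2 x).symm

end Limit

section Initial

variable {X : Type*} [MetricSpace X] [CompleteSpace X]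

/-- Any homeomorphism between decomposition spaces is, up to a small error, induced by a
homeomorphism of the space. -/
lemma exists_almost_lift {A B : Decomposition X} (hA : A.Vanishing) (hAs : A.ShrinksIn univ)
    (hB : B.Vanishing) (hBs : B.ShrinksIn univ) (f : A.Space ≃ₜ B.Space) {l : X → X}
    (hl : ∀ x, B.q (l x) = f (A.q x)) {ρ : X → X → ℝ} (hρ : B.IsQuotientPseudometric ρ) {r : ℝ}
    (hr : 0 < r) : ∃ Φ : X ≃ₜ X, ∀ x, ρ (Φ x) (l x) < 3 * r := by
  have hzero : ∀ x y, B.q x = B.q y → ρ x y = 0 := fun x y h =>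
    hρ.eq_zero x y (by rw [B.q_eq_iff.1 h]; exact B.mem_cls y)
  have hcov : A.IsSatCover (range fun z => {x | ρ z (l x) < r}) := by
    refine ⟨?_, fun x => ⟨_, mem_range_self (l x), ?_⟩⟩
    · rintro _ ⟨z, rfl⟩
      refine ⟨?_, fun x hx y hy => ?_⟩
      · have hV : IsOpen {p : B.Space | ∃ y, B.q y = p ∧ ρ z y < r} := by
          rw [← B.isQuotientMap_q.isOpen_preimage]
          convert! hρ.isOpen_ball z r using 1
          ext x
          refine ⟨fun ⟨y, hy, hyr⟩ => ?_, fun hx => ⟨x, rfl, hx⟩⟩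
          have h1 := hρ.tri z y x
          rw [hzero y x hy] at h1
          rw [mem_ofPred_eq]
          linarith
        convert! (hV.preimage f.continuous).preimage A.continuous_q using 1
        ext x
        refine ⟨fun hx => ⟨l x, hl x, hx⟩, fun ⟨y, hy, hyr⟩ => ?_⟩
        have h1 := hρ.tri z y (l x)
        rw [hzero y (l x) (hy.trans (hl x).symm)] at h1
        rw [mem_ofPred_eq]
        linarith
      · have h1 := hρ.tri z (l x) (l y)
        rw [hzero (l x) (l y) (by rw [hl, hl, A.q_eq_iff.2 (cls_eq (A.cls_mem x) hy)])] at h1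
        rw [mem_ofPred_eq] at hx ⊢
        linarith
    · rw [mem_ofPred_eq, hρ.refl]; exact hr
  obtain ⟨ρA, hρA, hball⟩ := hA.exists_pseudometric hcov
  obtain ⟨gA, hgA⟩ := hAs.exists_homeomorph hA hρA (ε := 1 / 2) (by norm_num)
  obtain ⟨gB, hgB⟩ := hBs.exists_homeomorph hB hρ hr
  refine ⟨(gA.symm.trans f).trans gB, fun y => ?_⟩
  obtain ⟨p, rfl⟩ := gA.surjective y
  obtain ⟨x, rfl⟩ := A.q_surjective p
  change ρ (gB (f (gA.symm (gA (A.q x))))) _ < _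
  rw [gA.symm_apply_apply, ← hl]
  obtain ⟨_, ⟨z, rfl⟩, hz⟩ := hball x
  have h1 : ρ z (l x) < r := hz x (by rw [hρA.refl]; norm_num)
  have h2 : ρ z (l (gA (A.q x))) < r := hz _ (by
    rw [hρA.symm]
    linarith [hgA x])
  have h3 := hgB (l x)
  have h4 := hρ.tri (gB (B.q (l x))) (l x) (l (gA (A.q x)))
  have h5 := hρ.tri (l x) z (l (gA (A.q x)))
  rw [hρ.symm (l x) z] at h5
  linarith

end Initial

end Decomposition

/-- Theorem: for dense `𝒦`-tame decompositions `A`, `B` of a strongly locally homogeneous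
completely metrizable space, the `(A,B)`-liftable homeomorphisms are dense in the space
of homeomorphisms `X/A → X/B` with the limitation topology: every homeomorphism `f` is
approximated, with respect to any open cover `𝒰` of `X/B`, by a liftable one. -/
theorem liftable_dense_in_homeo (X : Type*) [TopologicalSpace X]
    (hX : CompletelyMetrizable X) (hslh : StronglyLocallyHomogeneous X)
    (𝒦 : Set (Set X)) (h𝒦 : IsTameFamily 𝒦)
    (A B : Decomposition X) (hA : A.KTame 𝒦) (hAd : A.IsDenseDecomp)
    (hB : B.KTame 𝒦) (hBd : B.IsDenseDecomp) :
    ∀ f : A.Space ≃ₜ B.Space,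
      ∀ 𝒰 : Set (Set B.Space), (∀ u ∈ 𝒰, IsOpen u) → ⋃₀ 𝒰 = Set.univ →
        ∃ φ : A.Space ≃ₜ B.Space, Liftable A B φ ∧ Near ⇑f ⇑φ 𝒰 := by
  intro f 𝒰 h𝒰o h𝒰c
  obtain ⟨m, rfl, hc⟩ := hX
  have gA := hA.isGood hAd
  have gB := hB.isGood hBd
  have sA := gA.shrinksIn univ isOpen_univ fun _ _ => subset_univ _
  have sB := gB.shrinksIn univ isOpen_univ fun _ _ => subset_univ _
  have hcov : B.IsSatCover ((fun u => B.q ⁻¹' u) '' 𝒰) := by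
    refine ⟨?_, fun x => ?_⟩
    · rintro _ ⟨u, hu, rfl⟩
      refine ⟨(h𝒰o u hu).preimage B.continuous_q, fun x hx y hy => ?_⟩
      rw [mem_preimage, B.q_eq_iff.2 (Decomposition.cls_eq (B.cls_mem x) hy)]
      exact hx
    · obtain ⟨u, hu, hxu⟩ := h𝒰c.symm ▸ mem_univ (B.q x)
      exact ⟨_, mem_image_of_mem _ hu, hxu⟩
  obtain ⟨ρ, hρ, hball⟩ := gB.vanishing.exists_pseudometric hcov
  choose l hl using fun x => B.q_surjective (f (A.q x))
  obtain ⟨Φ₀, hΦ₀⟩ := Decomposition.exists_almost_lift gA.vanishing sA gB.vanishing sB f hl hρ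
    (r := 1 / 10000) (by norm_num)
  have hd := (isContPseudometric_dist X).add hρ.toIsContPseudometric
  obtain ⟨γ, S, -, hS, -, hγ, hSA, hSB⟩ := gA.exists_step (gB.comap h𝒦.2.1 Φ₀) h𝒦 hslh
    (Decomposition.matchedOn_empty _ _) (hρ.toIsContPseudometric.comp Φ₀.continuous) hd
    (hd.comp Φ₀.continuous) (ε := 6 / 10000) (ε' := 1 / 2 / 3376) (by norm_num) (by norm_num)
    (fun K hK _ x hx y hy => by
      have h1 : ρ (l x) (l y) = 0 := hρ.eq_zero _ _ (by
        have h2 : B.q (l x) = B.q (l y) := by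
          rw [hl, hl, A.q_eq_iff.2
            ((Decomposition.cls_eq hK hx).trans (Decomposition.cls_eq hK hy).symm)]
        rw [B.q_eq_iff.1 h2]
        exact B.mem_cls _)
      have h3 := hρ.tri (Φ₀ x) (l x) (Φ₀ y)
      have h4 := hρ.tri (l x) (l y) (Φ₀ y)
      have h5 := hΦ₀ y
      rw [hρ.symm] at h5
      linarith [hΦ₀ x])
    (fun K hK _ x hx y hy => by
      have h1 := hρ.eq_zero (Φ₀ x) (Φ₀ y) (by
        rw [Decomposition.cls_eq (Decomposition.mem_comap_pieces.1 hK) (mem_image_of_mem _ hx)]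
        exact mem_image_of_mem _ hy)
      rw [h1]
      norm_num)
  rw [Decomposition.comap_comap] at hS hSB
  obtain ⟨Φ, hΦ, hcls⟩ := gA.exists_homeomorph gB h𝒦 hslh hd
    (fun x y => by linarith [hρ.nonneg x y]) (η := 1 / 2) (by norm_num) hS hSA hSB
  obtain ⟨φ, hφ⟩ := Decomposition.exists_liftable Φ hcls
  refine ⟨φ, ⟨Φ, hφ⟩, fun z _ => ?_⟩
  obtain ⟨x, rfl⟩ := A.q_surjective z
  obtain ⟨_, ⟨u, hu, rfl⟩, hxu⟩ := hball (l x)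
  rw [← hl, ← hφ]
  refine ⟨u, hu, hxu _ (by rw [hρ.refl]; norm_num), hxu _ ?_⟩
  have h1 := hΦ₀ x
  have h2 := hγ x
  have h3 : dist (Φ₀ (γ x)) (Φ x) + ρ (Φ₀ (γ x)) (Φ x) ≤ 1 / 2 := hΦ x
  have h4 := hρ.tri (l x) (Φ₀ x) (Φ x)
  have h5 := hρ.tri (Φ₀ x) (Φ₀ (γ x)) (Φ x)
  rw [hρ.symm] at h1 h2
  linarith [dist_nonneg (x := Φ₀ (γ x)) (y := Φ x)]

end
end

section
/- Let K be a tame family of compact subsets of a metrizable topological space X. Then each compact set K ∈ K is: (1) point-like in X provided X is completely metrizable; (2) cell-like in X provided X is locally contractible; and (3) cellular in X provided X is a manifold modeled on I^ω or on ℝ^n for some n ∈ ℕ. -/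
open Set Topology unitInterval

noncomputable section

/-! ### Shrinking a compact set to a point by a convergent sequence of homeomorphisms -/

section Limit

variable {X : Type*} [TopologicalSpace X]

open Classical in
/-- The pointwise limit of a sequence of homeomorphisms `H n` in which a point `y` is no longer
moved once `H n y ∉ O n`. Points that never stabilize are left in place. -/
def stableLimit (H : ℕ → X ≃ₜ X) (O : ℕ → Set X) (y : X) : X :=
  if h : ∃ n, H n y ∉ O n then H h.choose y else y

variable {H : ℕ → X ≃ₜ X} {O : ℕ → Set X}

lemma stable_of_le (hO : ∀ n, closure (O (n + 1)) ⊆ O n)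
    (hH : ∀ n y, H n y ∉ O n → H (n + 1) y = H n y) {n m : ℕ} {y : X} (hy : H n y ∉ O n)
    (hnm : n ≤ m) : H m y = H n y ∧ H m y ∉ O m := by
  induction m, hnm using Nat.le_induction with
  | base => exact ⟨rfl, hy⟩
  | succ m _ ih =>
    have h := hH m y ih.2
    refine ⟨h.trans ih.1, fun h' => ih.2 ?_⟩
    rw [h] at h'
    exact hO m (subset_closure h')

lemma stableLimit_eq (hO : ∀ n, closure (O (n + 1)) ⊆ O n)
    (hH : ∀ n y, H n y ∉ O n → H (n + 1) y = H n y) {n : ℕ} {y : X} (hy : H n y ∉ O n) :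
    stableLimit H O y = H n y := by
  have h : ∃ n, H n y ∉ O n := ⟨n, hy⟩
  rw [stableLimit, dif_pos h]
  rcases le_total h.choose n with hle | hle
  · exact (stable_of_le hO hH h.choose_spec hle).1.symm
  · exact (stable_of_le hO hH hy hle).1

lemma continuousAt_stableLimit (hO : ∀ n, closure (O (n + 1)) ⊆ O n)
    (hH : ∀ n y, H n y ∉ O n → H (n + 1) y = H n y) {n : ℕ} {y : X} (hy : H n y ∉ O n) :
    ContinuousAt (stableLimit H O) y := by
  have hy' := stable_of_le hO hH hy n.le_succ
  have hcl : H (n + 1) y ∉ closure (O (n + 1)) := fun h => hy (hy'.1 ▸ hO n h)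
  have hnhds : H (n + 1) ⁻¹' (closure (O (n + 1)))ᶜ ∈ 𝓝 y :=
    (isClosed_closure.isOpen_compl.preimage (H (n + 1)).continuous).mem_nhds hcl
  refine (H (n + 1)).continuous.continuousAt.congr ?_
  filter_upwards [hnhds] with z hz
  exact (stableLimit_eq hO hH fun h => hz (subset_closure h)).symm

lemma mem_iff_of_stable (hH : ∀ n y, H n y ∉ O n → H (n + 1) y = H n y) (n : ℕ) (y : X) :
    H (n + 1) y ∈ O n ↔ H n y ∈ O n := by
  refine not_iff_not.1 ⟨fun h => ?_, fun h => by rwa [hH n y h]⟩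
  have h1 : H n ((H n).symm (H (n + 1) y)) ∉ O n := by simpa using h
  have h2 := hH n _ h1
  rw [Homeomorph.apply_symm_apply] at h2
  have h3 := (H (n + 1)).injective h2
  rwa [h3] at h1

lemma closure_preimage_subset_of_stable (hO : ∀ n, closure (O (n + 1)) ⊆ O n)
    (hH : ∀ n y, H n y ∉ O n → H (n + 1) y = H n y) (n : ℕ) :
    closure (H (n + 1) ⁻¹' O (n + 1)) ⊆ H n ⁻¹' O n := by
  intro y hy
  rw [← Homeomorph.preimage_closure] at hy
  exact (mem_iff_of_stable hH n y).1 (hO n hy)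

lemma symm_eq_of_stable (hH : ∀ n y, H n y ∉ O n → H (n + 1) y = H n y) (n : ℕ) (z : X)
    (hz : (H n).symm z ∉ H n ⁻¹' O n) : (H (n + 1)).symm z = (H n).symm z := by
  rw [Homeomorph.symm_apply_eq, hH n _ hz, Homeomorph.apply_symm_apply]

/-- The limit of the inverse homeomorphisms inverts the limit. -/
lemma stableLimit_symm_stableLimit (hO : ∀ n, closure (O (n + 1)) ⊆ O n)
    (hH : ∀ n y, H n y ∉ O n → H (n + 1) y = H n y) {n : ℕ} {y : X} (hy : H n y ∉ O n) :
    stableLimit (fun n => (H n).symm) (fun n => H n ⁻¹' O n) (stableLimit H O y) = y := by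
  rw [stableLimit_eq hO hH hy,
    stableLimit_eq (H := fun n => (H n).symm) (O := fun n => H n ⁻¹' O n)
      (closure_preimage_subset_of_stable hO hH) (symm_eq_of_stable hH) (n := n) (by simpa using hy)]
  simp

lemma stableLimit_stableLimit_symm (hO : ∀ n, closure (O (n + 1)) ⊆ O n)
    (hH : ∀ n y, H n y ∉ O n → H (n + 1) y = H n y) {n : ℕ} {z : X} (hz : z ∉ O n) :
    stableLimit H O (stableLimit (fun n => (H n).symm) (fun n => H n ⁻¹' O n) z) = z := by
  rw [stableLimit_eq (H := fun n => (H n).symm) (O := fun n => H n ⁻¹' O n)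
      (closure_preimage_subset_of_stable hO hH) (symm_eq_of_stable hH) (n := n) (by simpa using hz),
    stableLimit_eq hO hH (n := n) (by simpa using hz)]
  simp

/-- If a stabilizing sequence of homeomorphisms is supported in `N` and squeezes `K` to the
point `x`, then its limit is a homeomorphism of `N \ K` onto `N \ {x}`. -/
lemma nonempty_homeomorph_diff_of_stable (hO : ∀ n, closure (O (n + 1)) ⊆ O n)
    (hH : ∀ n y, H n y ∉ O n → H (n + 1) y = H n y) (h0 : ∀ y, H 0 y = y) {N K : Set X} {x : X}
    (hN : O 0 ⊆ N) (hK : ∀ y, y ∈ K ↔ ∀ n, H n y ∈ O n) (hx : ∀ z, z = x ↔ ∀ n, z ∈ O n) :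
    Nonempty (↥(N \ K) ≃ₜ ↥(N \ {x})) := by
  set L := stableLimit H O with hL
  set M := stableLimit (fun n => (H n).symm) (fun n => H n ⁻¹' O n) with hM
  have hO' := closure_preimage_subset_of_stable hO hH
  have hH' := symm_eq_of_stable hH
  have hK' : ∀ {y}, y ∉ K → ∃ n, H n y ∉ O n := fun {y} h => by simpa [hK] using h
  have hx' : ∀ {z}, z ≠ x → ∃ n, z ∉ O n := fun {z} h => by simpa [hx] using h
  have hML : ∀ y, y ∉ K → M (L y) = y := fun y hy =>
    stableLimit_symm_stableLimit hO hH (hK' hy).choose_spec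
  have hLM : ∀ z, z ≠ x → L (M z) = z := fun z hz =>
    stableLimit_stableLimit_symm hO hH (hx' hz).choose_spec
  have hL0 : ∀ y, y ∉ O 0 → L y = y := fun y hy => by
    rw [hL, stableLimit_eq hO hH (n := 0) (by rwa [h0]), h0]
  have hM0 : ∀ z, z ∉ O 0 → M z = z := fun z hz => by
    have h : (H 0).symm z = z := by rw [Homeomorph.symm_apply_eq, h0]
    rw [hM, stableLimit_eq (H := fun n => (H n).symm) hO' hH' (n := 0) (by simpa using hz), h]
  have hLx : ∀ y, y ∉ K → L y ≠ x := fun y hy => by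
    obtain ⟨n, hn⟩ := hK' hy
    rw [hL, stableLimit_eq hO hH hn]
    exact fun h => hn ((hx _).1 h n)
  have hMK : ∀ z, z ≠ x → M z ∉ K := fun z hz => by
    obtain ⟨n, hn⟩ := hx' hz
    rw [hM, stableLimit_eq (H := fun n => (H n).symm) hO' hH' (n := n) (by simpa using hn)]
    exact fun h => hn (by simpa using (hK _).1 h n)
  have hLN : ∀ y ∈ N, y ∉ K → L y ∈ N := fun y hy hyK => by
    by_cases h : L y ∈ O 0
    · exact hN h
    · rwa [← (hM0 _ h).symm.trans (hML y hyK)] at hy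
  have hMN : ∀ z ∈ N, z ≠ x → M z ∈ N := fun z hz hzx => by
    by_cases h : M z ∈ O 0
    · exact hN h
    · rwa [← (hL0 _ h).symm.trans (hLM z hzx)] at hz
  refine ⟨{ toFun := fun y => ⟨L y, hLN y y.2.1 y.2.2, hLx y y.2.2⟩
            invFun := fun z => ⟨M z, hMN z z.2.1 z.2.2, hMK z z.2.2⟩
            left_inv := fun y => Subtype.ext (hML y y.2.2)
            right_inv := fun z => Subtype.ext (hLM z z.2.2)
            continuous_toFun := ?_
            continuous_invFun := ?_ }⟩
  · refine Continuous.subtype_mk (continuous_iff_continuousAt.2 fun y => ?_) _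
    obtain ⟨n, hn⟩ := hK' y.2.2
    exact (continuousAt_stableLimit hO hH hn).comp continuous_subtype_val.continuousAt
  · refine Continuous.subtype_mk (continuous_iff_continuousAt.2 fun z => ?_) _
    obtain ⟨n, hn⟩ := hx' z.2.2
    exact (continuousAt_stableLimit (H := fun n => (H n).symm) hO' hH' (n := n)
      (by simpa using hn)).comp continuous_subtype_val.continuousAt

end Limit

lemma LocallyShrinkable.nonempty {X : Type*} [TopologicalSpace X] {K : Set X}
    (hK : LocallyShrinkable K) : K.Nonempty := by
  rw [nonempty_iff_ne_empty]
  rintro rfl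
  obtain ⟨_, _, v, hv, _⟩ := hK ∅ isOpen_empty subset_rfl ∅ (by simp) (by simp)
  exact hv

/-- A locally shrinkable compact set can be squeezed into an open set of small diameter whose
preimage is contained in a prescribed neighborhood of the set. -/
lemma exists_squeeze {X : Type*} [MetricSpace X] {K : Set X} (hc : IsCompact K)
    (hK : LocallyShrinkable K) {O W : Set X} (hO : IsOpen O) (hKO : K ⊆ O) (hW : IsOpen W)
    (hKW : K ⊆ W) {ε : ℝ} (hε : 0 < ε) :
    ∃ (h : X ≃ₜ X) (O' : Set X), (∀ y ∉ O, h y = y) ∧ IsOpen O' ∧ ⇑h '' K ⊆ O' ∧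
      closure O' ⊆ O ∧ h ⁻¹' O' ⊆ W ∧ ∃ c, O' ⊆ Metric.ball c ε := by
  obtain ⟨h, hsupp, v, ⟨c, rfl⟩, hv⟩ := hK O hO hKO
    (range fun c : X => Metric.ball c ε ∩ O)
    (by rintro _ ⟨c, rfl⟩; exact ⟨Metric.isOpen_ball.inter hO, inter_subset_right⟩)
    (fun y hy => ⟨_, ⟨y, rfl⟩, Metric.mem_ball_self hε, hy⟩)
  obtain ⟨O', hO', hKO', hcl⟩ := normal_exists_closure_subset (hc.image h.continuous).isClosed
    ((Metric.isOpen_ball.inter hO).inter (h.isOpenMap _ hW)) (subset_inter hv (image_mono hKW))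
  refine ⟨h, O', hsupp, hO', hKO', hcl.trans fun y hy => hy.1.2, fun y hy => ?_, c,
    subset_closure.trans (hcl.trans fun y hy => hy.1.1)⟩
  obtain ⟨w, hw, hwy⟩ := (hcl (subset_closure hy)).2
  exact h.injective hwy ▸ hw

/-- Compact sets all of whose ambient images are locally shrinkable are point-like in a complete
metric space. -/
lemma pointLike_of_locallyShrinkable {X : Type*} [MetricSpace X] [CompleteSpace X] {K : Set X}
    (hc : IsCompact K) (hK : ∀ h : X ≃ₜ X, LocallyShrinkable (⇑h '' K)) : PointLike K := by
  intro N _ hKN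
  have step : ∀ (n : ℕ) (s : {s : (X ≃ₜ X) × Set X // IsOpen s.2 ∧ ⇑s.1 '' K ⊆ s.2}),
      ∃ s' : {s : (X ≃ₜ X) × Set X // IsOpen s.2 ∧ ⇑s.1 '' K ⊆ s.2},
        (∀ y, s.1.1 y ∉ s.1.2 → s'.1.1 y = s.1.1 y) ∧ closure s'.1.2 ⊆ s.1.2 ∧
        s'.1.1 ⁻¹' s'.1.2 ⊆ Metric.thickening (1 / ((n : ℝ) + 1)) K ∧
        ∃ c, s'.1.2 ⊆ Metric.ball c (1 / ((n : ℝ) + 1)) := by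
    rintro n ⟨⟨H, O⟩, hO, hHO⟩
    have hn : 0 < 1 / ((n : ℝ) + 1) := Nat.one_div_pos_of_nat
    obtain ⟨h, O', hsupp, hO', hKO', hcl, hpre, hball⟩ :=
      exists_squeeze (hc.image H.continuous) (hK H) hO hHO
        (H.isOpenMap _ Metric.isOpen_thickening)
        (image_mono (Metric.self_subset_thickening hn K)) hn
    refine ⟨⟨⟨H.trans h, O'⟩, hO', ?_⟩, fun y hy => hsupp _ hy, hcl, fun y hy => ?_, hball⟩
    · rwa [image_image] at hKO'
    · obtain ⟨w, hw, hwy⟩ := hpre hy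
      exact H.injective hwy ▸ hw
  choose f hf using step
  let s : ℕ → {s : (X ≃ₜ X) × Set X // IsOpen s.2 ∧ ⇑s.1 '' K ⊆ s.2} := fun n =>
    Nat.rec ⟨⟨Homeomorph.refl X, interior N⟩, isOpen_interior, by simpa using hKN⟩ f n
  set H : ℕ → X ≃ₜ X := fun n => (s n).1.1
  set O : ℕ → Set X := fun n => (s n).1.2
  have hO : ∀ n, closure (O (n + 1)) ⊆ O n := fun n => (hf n (s n)).2.1
  have hH : ∀ n y, H n y ∉ O n → H (n + 1) y = H n y := fun n => (hf n (s n)).1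
  have hpre : ∀ n, H (n + 1) ⁻¹' O (n + 1) ⊆ Metric.thickening (1 / ((n : ℝ) + 1)) K :=
    fun n => (hf n (s n)).2.2.1
  have hball : ∀ n, ∃ c, O (n + 1) ⊆ Metric.ball c (1 / ((n : ℝ) + 1)) :=
    fun n => (hf n (s n)).2.2.2
  have hKO : ∀ n, ⇑(H n) '' K ⊆ O n := fun n => (s n).2.2
  have hanti : Antitone O := antitone_nat_of_succ_le fun n => subset_closure.trans (hO n)
  obtain ⟨k, hk⟩ : K.Nonempty := (hK (Homeomorph.refl X)).nonempty.of_image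
  have hkO : ∀ {m n}, m ≤ n → H n k ∈ O m := fun {m n} hmn => hanti hmn (hKO n ⟨k, hk, rfl⟩)
  have hdist : ∀ n, ∀ y ∈ O (n + 1), ∀ z ∈ O (n + 1), dist y z ≤ 2 * (1 / ((n : ℝ) + 1)) := by
    intro n y hy z hz
    obtain ⟨c, hcb⟩ := hball n
    have h1 := Metric.mem_ball.1 (hcb hy)
    have h2 := Metric.mem_ball'.1 (hcb hz)
    linarith [dist_triangle y c z]
  have hlim : Filter.Tendsto (fun n : ℕ => 2 * (1 / ((n : ℝ) + 1))) Filter.atTop (𝓝 0) := by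
    simpa using tendsto_one_div_add_atTop_nhds_zero_nat.const_mul (2 : ℝ)
  have hcauchy : CauchySeq fun n => H (n + 1) k :=
    cauchySeq_of_le_tendsto_0 _ (fun n m p hn hm =>
      hdist p _ (hkO (Nat.succ_le_succ hn)) _ (hkO (Nat.succ_le_succ hm))) hlim
  obtain ⟨x, hx⟩ := cauchySeq_tendsto_of_complete hcauchy
  have hxO : ∀ n, x ∈ O n := fun n => hO n <| mem_closure_of_tendsto hx <|
    Filter.eventually_atTop.2 ⟨n, fun m hm => hkO (Nat.succ_le_succ hm)⟩
  refine ⟨x, hxO 0, nonempty_homeomorph_diff_of_stable hO hH (fun y => rfl) interior_subset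
    (fun y => ⟨fun hy n => hKO n ⟨y, hy, rfl⟩, fun hy => ?_⟩) fun z => ⟨?_, fun hz => ?_⟩⟩
  · rw [← hc.isClosed.closure_eq, Metric.closure_eq_iInter_thickening, mem_iInter₂]
    intro δ hδ
    obtain ⟨n, hn⟩ := exists_nat_one_div_lt hδ
    exact Metric.thickening_mono hn.le K (hpre n (hy (n + 1)))
  · rintro rfl
    exact hxO
  · exact dist_le_zero.1 (ge_of_tendsto' hlim fun n => hdist n z (hz (n + 1)) x (hxO (n + 1)))

/-! ### Cell-like and cellular sets -/

/-- A homeomorphism supported in `U` maps `U` into itself. -/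
lemma mapsTo_of_supported {X : Type*} [TopologicalSpace X] {U : Set X} (h : X ≃ₜ X)
    (hU : ∀ x ∉ U, h x = x) : MapsTo h U U := by
  intro x hx
  by_contra hhx
  exact hhx (by rwa [h.injective (hU _ hhx)])

lemma symm_apply_of_supported {X : Type*} [TopologicalSpace X] {U : Set X} (h : X ≃ₜ X)
    (hU : ∀ x ∉ U, h x = x) : ∀ x ∉ U, h.symm x = x := fun x hx => by
  rw [Homeomorph.symm_apply_eq, hU x hx]

/-- A locally shrinkable set can be moved inside its neighborhood `U` into a small neighborhood
of some point of `U`. -/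
lemma LocallyShrinkable.exists_image_subset {X : Type*} [TopologicalSpace X] {K U : Set X}
    (hK : LocallyShrinkable K) (hU : IsOpen U) (hKU : K ⊆ U) {P : Set X → Prop}
    (hP : ∀ x ∈ U, ∃ V ∈ 𝓝 x, V ⊆ U ∧ P V) :
    ∃ (h : X ≃ₜ X) (V : Set X), (∀ x ∉ U, h x = x) ∧ ⇑h '' K ⊆ interior V ∧ V ⊆ U ∧ P V := by
  obtain ⟨h, hsupp, _, ⟨V, ⟨hVU, hPV⟩, rfl⟩, hv⟩ :=
    hK U hU hKU (interior '' {V | V ⊆ U ∧ P V})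
      (by rintro _ ⟨V, hV, rfl⟩; exact ⟨isOpen_interior, interior_subset.trans hV.1⟩)
      (fun x hx => by
        obtain ⟨V, hxV, hV⟩ := hP x hx
        exact ⟨_, ⟨V, hV, rfl⟩, mem_interior_iff_mem_nhds.2 hxV⟩)
  exact ⟨h, V, hsupp, hv, hVU, hPV⟩

/-- Contractibility in `U` can be transported along a homeomorphism supported in `U`. -/
lemma ContractibleIn.of_image_subset {X : Type*} [TopologicalSpace X] {K V U : Set X}
    (hV : ContractibleIn V U) (h : X ≃ₜ X) (hU : ∀ x ∉ U, h x = x) (hKV : ⇑h '' K ⊆ V) :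
    ContractibleIn K U := by
  obtain ⟨hVU, y, hVy⟩ := hV
  have hmap := mapsTo_of_supported h.symm (symm_apply_of_supported h hU)
  let f : C(K, V) := ⟨fun x => ⟨h x, hKV ⟨x, x.2, rfl⟩⟩, by fun_prop⟩
  let g : C(U, U) := ⟨hmap.restrict _ _ _, h.symm.continuous.restrict hmap⟩
  have hKU : K ⊆ U := fun x hx => by
    simpa using hmap (hVU (hKV ⟨x, hx, rfl⟩))
  refine ⟨hKU, g y, ?_⟩
  have key := ((ContinuousMap.Homotopic.refl g).comp hVy).comp (ContinuousMap.Homotopic.refl f)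
  convert key using 1
  · ext x
    simp [f, g]
  · rfl

lemma LocallyShrinkable.cellLike {X : Type*} [TopologicalSpace X] {K : Set X}
    (hK : LocallyShrinkable K) (hX : LocallyContractible X) : CellLike K := by
  intro U hU hKU
  obtain ⟨h, V, hsupp, hKV, -, hV⟩ := hK.exists_image_subset hU hKU
    (P := fun V => ContractibleIn V U) fun x hx => hX x U (hU.mem_nhds hx)
  exact hV.of_image_subset h hsupp (hKV.trans interior_subset)

/-- Each point of `X` has arbitrarily small neighborhoods homeomorphic to `E`. -/
def LocallyModeledOn (X : Type*) [TopologicalSpace X] (E : Type*) [TopologicalSpace E] : Prop :=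
  ∀ x : X, ∀ U ∈ 𝓝 x, ∃ V ∈ 𝓝 x, V ⊆ U ∧ Nonempty (↥V ≃ₜ E)

lemma LocallyShrinkable.cellularIn {X E : Type*} [TopologicalSpace X] [TopologicalSpace E]
    {K : Set X} (hK : LocallyShrinkable K) (hX : LocallyModeledOn X E) : CellularIn E K := by
  intro U hU hKU
  obtain ⟨h, V, hsupp, hKV, hVU, ⟨e⟩⟩ := hK.exists_image_subset hU hKU
    (P := fun V => Nonempty (↥V ≃ₜ E)) fun x hx => hX x U (hU.mem_nhds hx)
  refine ⟨⇑h.symm '' V, mem_nhdsSet_iff_forall.2 fun x hx => ?_, ?_,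
    ⟨(h.symm.image V).symm.trans e⟩⟩
  · rw [Homeomorph.image_symm]
    exact h.continuous.continuousAt.preimage_mem_nhds
      (mem_interior_iff_mem_nhds.1 (hKV ⟨x, hx, rfl⟩))
  · exact ((mapsTo_of_supported h.symm
      (symm_apply_of_supported h hsupp)).mono_left hVU).image_subset

lemma IsManifoldModeledOn.locallyModeledOn {X E F : Type*} [TopologicalSpace X]
    [TopologicalSpace E] [TopologicalSpace F] (hX : IsManifoldModeledOn X E)
    (hE : LocallyModeledOn E F) : LocallyModeledOn X F := by
  intro x W hW
  obtain ⟨O, hO, hxO, U, hU, ⟨e⟩⟩ := hX.2 x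
  have hφ : IsOpenEmbedding (fun u : U => (e.symm u : X)) :=
    hO.isOpenEmbedding_subtypeVal.comp e.symm.isOpenEmbedding
  set φ : U → X := fun u => (e.symm u : X)
  set u : U := e ⟨x, hxO⟩
  have hφu : φ u = x := by simp [φ, u]
  have hW' : Subtype.val '' (φ ⁻¹' W) ∈ 𝓝 (u : E) :=
    hU.isOpenEmbedding_subtypeVal.isOpenMap.image_mem_nhds
      (hφ.continuous.continuousAt.preimage_mem_nhds (by rwa [hφu]))
  obtain ⟨V, hV, hVW, ⟨f⟩⟩ := hE u _ hW'
  have hVU : V ⊆ range ((↑) : U → E) := hVW.trans (image_subset_range _ _)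
  refine ⟨φ '' (Subtype.val ⁻¹' V), ?_, ?_, ⟨?_⟩⟩
  · rw [← hφu]
    exact hφ.isOpenMap.image_mem_nhds (continuous_subtype_val.continuousAt.preimage_mem_nhds hV)
  · rintro _ ⟨v, hv, rfl⟩
    obtain ⟨w, hw, hwv⟩ := hVW hv
    rwa [← Subtype.ext hwv]
  · exact (hφ.isEmbedding.homeomorphImage _).symm.trans
      ((IsEmbedding.subtypeVal.homeomorphImage _).trans
        ((Homeomorph.setCongr (image_preimage_eq_of_subset hVU)).trans f))

lemma locallyModeledOn_self (E : Type*) [NormedAddCommGroup E] [NormedSpace ℝ E] :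
    LocallyModeledOn E E := by
  intro x U hU
  obtain ⟨r, hr, hrU⟩ := Metric.mem_nhds_iff.1 hU
  refine ⟨Metric.ball x r, Metric.ball_mem_nhds x hr, hrU, ⟨?_⟩⟩
  have e := (OpenPartialHomeomorph.univBall x r).toHomeomorphSourceTarget
  rw [OpenPartialHomeomorph.univBall_source, OpenPartialHomeomorph.univBall_target x hr] at e
  exact e.symm.trans (Homeomorph.Set.univ E)

/-! ### Small open sets in the Hilbert cube -/

/-- Multiplying by the half-line makes a cone in the line indistinguishable from its part in
`[-1, 1]`. -/
def coneProdHomeomorph (C : Set ℝ) (hC : ∀ s ∈ C, ∀ r : ℝ, 0 < r → s * r ∈ C) :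
    ↥(C ∩ Icc (-1 : ℝ) 1) × ↥(Ici (0 : ℝ)) ≃ₜ ↥C × ↥(Ici (0 : ℝ)) where
  toFun p := (⟨p.1 * (p.2 + 1), hC _ p.1.2.1 _ (by have := p.2.2.out; linarith)⟩,
    ⟨p.2 - max 0 (|(p.1 : ℝ) * (p.2 + 1)| - 1), by
      have ht := p.2.2.out
      have hs := abs_le.2 p.1.2.2
      rw [mem_Ici, sub_nonneg, abs_mul, abs_of_pos (by linarith : (0 : ℝ) < p.2 + 1)]
      exact max_le ht (by nlinarith)⟩)
  invFun q := (⟨q.1 * (q.2 + max 0 (|(q.1 : ℝ)| - 1) + 1)⁻¹, by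
      have ht := q.2.2.out
      have hm := le_max_left 0 (|(q.1 : ℝ)| - 1)
      have hm' := le_max_right 0 (|(q.1 : ℝ)| - 1)
      have hpos : 0 < (q.2 : ℝ) + max 0 (|(q.1 : ℝ)| - 1) + 1 := by linarith
      refine ⟨hC _ q.1.2 _ (inv_pos.2 hpos), abs_le.1 ?_⟩
      rw [abs_mul, abs_of_pos (inv_pos.2 hpos), ← div_eq_mul_inv, div_le_one hpos]
      linarith⟩,
    ⟨q.2 + max 0 (|(q.1 : ℝ)| - 1), add_nonneg q.2.2.out (le_max_left _ _)⟩)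
  left_inv p := by
    have ht := p.2.2.out
    ext
    · have : (p.2 : ℝ) + 1 ≠ 0 := by linarith
      simp [this]
    · simp
  right_inv q := by
    have ht := q.2.2.out
    have hm := le_max_left 0 (|(q.1 : ℝ)| - 1)
    have hpos : (q.2 : ℝ) + max 0 (|(q.1 : ℝ)| - 1) + 1 ≠ 0 := by linarith
    ext <;> simp [hpos]
  continuous_toFun := by fun_prop
  continuous_invFun := by
    have : ∀ q : ↥C × ↥(Ici (0 : ℝ)), (q.2 : ℝ) + max 0 (|(q.1 : ℝ)| - 1) + 1 ≠ 0 := fun q => by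
      have ht := q.2.2.out
      have hm := le_max_left 0 (|(q.1 : ℝ)| - 1)
      linarith
    refine Continuous.prodMk (Continuous.subtype_mk (Continuous.mul (by fun_prop)
      (Continuous.inv₀ (by fun_prop) this)) _) (by fun_prop)

/-- The map `s ↦ x + ε * (s / (1 + |s|))` is a homeomorphism onto a ball in the unit interval. -/
def ballHomeomorph (x ε : ℝ) (hε : 0 < ε) :
    ↥{y : I | |(y : ℝ) - x| < ε} ≃ₜ ↥{s : ℝ | x + ε * (s / (1 + |s|)) ∈ I} :=
  have key : ∀ u : ℝ, |u| < 1 → u / (1 - |u|) / (1 + |u / (1 - |u|)|) = u := fun u hu => by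
    have h1 : 0 < 1 - |u| := by linarith
    rw [abs_div, abs_of_pos h1]
    field_simp
    ring
  have key' : ∀ s : ℝ, s / (1 + |s|) / (1 - |s / (1 + |s|)|) = s := fun s => by
    have h1 : 0 < 1 + |s| := by positivity
    rw [abs_div, abs_of_pos h1]
    field_simp
    ring
  have hball : ∀ s : ℝ, |s / (1 + |s|)| < 1 := fun s => by
    have h1 : 0 < 1 + |s| := by positivity
    rw [abs_div, abs_of_pos h1, div_lt_one h1]
    linarith
  have hlt : ∀ y : ↥{y : I | |(y : ℝ) - x| < ε}, |((y : I) - x) / ε| < 1 := fun y => by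
    rw [abs_div, abs_of_pos hε, div_lt_one hε]
    exact y.2
  { toFun := fun y => ⟨((y : I) - x) / ε / (1 - |((y : I) - x) / ε|), by
      rw [mem_ofPred_eq, key _ (hlt y), mul_div_cancel₀ _ hε.ne', add_sub_cancel]
      exact y.1.2⟩
    invFun := fun s => ⟨⟨x + ε * (s / (1 + |(s : ℝ)|)), s.2⟩, by
      rw [mem_ofPred_eq, add_sub_cancel_left, abs_mul, abs_of_pos hε]
      exact mul_lt_of_lt_one_right hε (hball s)⟩
    left_inv := fun y => by
      ext
      simp only [key _ (hlt y)]
      field_simp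
      ring
    right_inv := fun s => by
      ext
      simp only [add_sub_cancel_left, mul_div_cancel_left₀ _ hε.ne']
      exact key' s
    continuous_toFun := by
      refine Continuous.subtype_mk (Continuous.div (by fun_prop) (by fun_prop) fun y => ?_) _
      linarith [hlt y]
    continuous_invFun := by
      refine Continuous.subtype_mk (Continuous.subtype_mk (continuous_const.add
        (continuous_const.mul (Continuous.div (by fun_prop) (by fun_prop) fun s => ?_))) _) _
      positivity }

lemma setOf_add_mul_div_mem_eq_Ici {ε : ℝ} (hε : 0 < ε) (hε1 : ε ≤ 1) :
    {s : ℝ | 0 + ε * (s / (1 + |s|)) ∈ I} = Ici 0 := by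
  ext s
  have h1 : 0 < 1 + |s| := by positivity
  rw [mem_ofPred_eq, mem_Ici, zero_add]
  refine ⟨fun h => ?_, fun h => ⟨by positivity, ?_⟩⟩
  · by_contra! hs
    exact absurd h.1 (not_le.2 (mul_neg_of_pos_of_neg hε (div_neg_of_neg_of_pos hs h1)))
  · refine mul_le_one₀ hε1 (by positivity) ((div_le_one h1).2 ?_)
    linarith [le_abs_self s]

lemma setOf_add_mul_div_mem_eq_Iic {ε : ℝ} (hε : 0 < ε) (hε1 : ε ≤ 1) :
    {s : ℝ | 1 + ε * (s / (1 + |s|)) ∈ I} = Iic 0 := by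
  ext s
  have h := Set.ext_iff.1 (setOf_add_mul_div_mem_eq_Ici hε hε1) (-s)
  simp only [mem_ofPred_eq, abs_neg, mem_Ici, Left.nonneg_neg_iff, mem_Icc] at h
  rw [mem_ofPred_eq, mem_Iic, ← h, neg_div]
  constructor <;> rintro ⟨h1, h2⟩ <;> constructor <;> linarith

lemma setOf_add_mul_div_mem_eq_univ {x ε : ℝ} (hε : 0 < ε) (h0 : ε ≤ x) (h1 : ε ≤ 1 - x) :
    {s : ℝ | x + ε * (s / (1 + |s|)) ∈ I} = univ := by
  refine eq_univ_of_forall fun s => ?_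
  have hs : 0 < 1 + |s| := by positivity
  have h : |s / (1 + |s|)| ≤ 1 := by
    rw [abs_div, abs_of_pos hs, div_le_one hs]
    linarith
  obtain ⟨h2, h3⟩ := abs_le.1 h
  constructor <;> nlinarith

/-- Each point of the unit interval has arbitrarily small neighborhoods whose product with the
half-line is homeomorphic to the product of the interval with the half-line. -/
lemma exists_nhds_prod_homeomorph (x : I) {W : Set I} (hW : W ∈ 𝓝 x) :
    ∃ S ∈ 𝓝 x, S ⊆ W ∧ Nonempty (↥S × ↥(Ici (0 : ℝ)) ≃ₜ I × ↥(Ici (0 : ℝ))) := by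
  obtain ⟨δ, hδ, hδW⟩ := Metric.mem_nhds_iff.1 hW
  have main : ∀ (ε : ℝ) (C : Set ℝ) (a b : ℝ), 0 < ε → ε ≤ δ →
      {s : ℝ | (x : ℝ) + ε * (s / (1 + |s|)) ∈ I} = C →
      (∀ s ∈ C, ∀ r : ℝ, 0 < r → s * r ∈ C) → a < b → C ∩ Icc (-1) 1 = Icc a b →
      ∃ S ∈ 𝓝 x, S ⊆ W ∧ Nonempty (↥S × ↥(Ici (0 : ℝ)) ≃ₜ I × ↥(Ici (0 : ℝ))) := by
    intro ε C a b hε hεδ hC hcone hab hCab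
    refine ⟨{y : I | |(y : ℝ) - x| < ε}, Metric.ball_mem_nhds x hε,
      fun y hy => hδW (hy.trans_le hεδ), ⟨?_⟩⟩
    exact (((ballHomeomorph x ε hε).trans (Homeomorph.setCongr hC)).prodCongr
      (Homeomorph.refl _)).trans ((coneProdHomeomorph C hcone).symm.trans
        (((Homeomorph.setCongr hCab).trans (iccHomeoI a b hab)).prodCongr (Homeomorph.refl _)))
  rcases eq_or_lt_of_le x.2.1 with h0 | h0
  · refine main (min δ 1) (Ici 0) 0 1 (by positivity) (min_le_left _ _) ?_ ?_ one_pos ?_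
    · rw [← h0]
      exact setOf_add_mul_div_mem_eq_Ici (by positivity) (min_le_right _ _)
    · exact fun s hs r hr => mul_nonneg hs hr.le
    · ext s
      simp only [mem_inter_iff, mem_Ici, mem_Icc]
      grind
  rcases eq_or_lt_of_le x.2.2 with h1 | h1
  · refine main (min δ 1) (Iic 0) (-1) 0 (by positivity) (min_le_left _ _) ?_ ?_ (by simp) ?_
    · rw [h1]
      exact setOf_add_mul_div_mem_eq_Iic (by positivity) (min_le_right _ _)
    · exact fun s hs r hr => mul_nonpos_of_nonpos_of_nonneg hs hr.le
    · ext s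
      simp only [mem_inter_iff, mem_Iic, mem_Icc]
      grind
  · refine main (min δ (min x (1 - x))) univ (-1) 1 (by simp [*]) (min_le_left _ _) ?_ ?_
      (by norm_num) (univ_inter _)
    · exact setOf_add_mul_div_mem_eq_univ (by simp [*])
        ((min_le_right _ _).trans (min_le_left _ _)) ((min_le_right _ _).trans (min_le_right _ _))
    · exact fun s _ r _ => mem_univ _

/-- Each point of the unit interval has a neighborhood homeomorphic to the half-line. -/
lemma exists_nhds_homeomorph_Ici (x : I) : ∃ S ∈ 𝓝 x, Nonempty (↥S ≃ₜ ↥(Ici (0 : ℝ))) := by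
  have hopen : ∀ a : ℝ, IsOpen {y : I | |(y : ℝ) - a| < 1} := fun a =>
    isOpen_lt (by fun_prop) continuous_const
  rcases lt_or_ge (x : ℝ) 1 with h | h
  · exact ⟨_, (hopen 0).mem_nhds (by simpa [abs_of_nonneg x.2.1] using h),
      ⟨(ballHomeomorph 0 1 one_pos).trans
        (Homeomorph.setCongr (setOf_add_mul_div_mem_eq_Ici one_pos le_rfl))⟩⟩
  · refine ⟨_, (hopen 1).mem_nhds (by simp [le_antisymm x.2.2 h]),
      ⟨((ballHomeomorph 1 1 one_pos).trans
        (Homeomorph.setCongr (setOf_add_mul_div_mem_eq_Iic one_pos le_rfl))).trans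
        ((Homeomorph.neg ℝ).subtype fun y => ?_)⟩⟩
    simp

/-- The half-line is homeomorphic to `[0, 1)`. -/
def halfLineHomeomorphIco : ↥(Ici (0 : ℝ)) ≃ₜ ↥(Ico (0 : ℝ) 1) :=
  ((Homeomorph.setCongr (setOf_add_mul_div_mem_eq_Ici one_pos le_rfl)).symm.trans
    (ballHomeomorph 0 1 one_pos).symm).trans
  { toFun := fun y => ⟨y.1, y.1.2.1, by simpa [abs_of_nonneg y.1.2.1] using y.2⟩
    invFun := fun y => ⟨⟨y, y.2.1, y.2.2.le⟩, by simpa [abs_of_nonneg y.2.1] using y.2.2⟩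
    left_inv := fun _ => rfl
    right_inv := fun _ => rfl
    continuous_toFun := by fun_prop
    continuous_invFun := by fun_prop }

open Classical in
/-- If finitely many factors of a cube are replaced by sets that become homeomorphic to the
interval after multiplication by `T`, then the product with `T` does not change. -/
lemma nonempty_pi_prod_homeomorph {ι T : Type*} [TopologicalSpace T] (F : Finset ι) :
    ∀ S : ι → Set I, (∀ i ∈ F, Nonempty (↥(S i) × T ≃ₜ I × T)) → (∀ i ∉ F, S i = univ) →
      Nonempty ((∀ i, ↥(S i)) × T ≃ₜ (ι → I) × T) := by
  induction F using Finset.induction_on with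
  | empty =>
    intro S _ hS
    exact ⟨(Homeomorph.piCongrRight fun i => (Homeomorph.setCongr (hS i (by simp))).trans
      (Homeomorph.Set.univ I)).prodCongr (Homeomorph.refl T)⟩
  | insert a F ha ih =>
    intro S hF hS
    set S' : ι → Set I := Function.update S a univ with hS'
    have hne : ∀ i, i ≠ a → S i = S' i := fun i hi => (Function.update_of_ne hi _ _).symm
    have ha' : S' a = univ := Function.update_self _ _ _
    obtain ⟨e⟩ := hF a (Finset.mem_insert_self a F)
    obtain ⟨e'⟩ := ih S' (fun i hi => by
        rw [← hne i (ne_of_mem_of_not_mem hi ha)]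
        exact hF i (Finset.mem_insert_of_mem hi)) fun i hi => by
      by_cases hia : i = a
      · rw [hia, ha']
      · rw [← hne i hia]
        exact hS i (by simp [hia, hi])
    let split : ∀ A : ι → Set I, (∀ i, ↥(A i)) ≃ₜ (∀ i : {i // i ≠ a}, ↥(A i)) × ↥(A a) :=
      fun A => (Homeomorph.piSplitAt a fun i => ↥(A i)).trans (Homeomorph.prodComm _ _)
    let rest : (∀ i : {i // i ≠ a}, ↥(S i)) ≃ₜ ∀ i : {i // i ≠ a}, ↥(S' i) :=
      Homeomorph.piCongrRight fun i => Homeomorph.setCongr (hne i i.2)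
    let last : ↥(S a) × T ≃ₜ ↥(S' a) × T := e.trans
      (((Homeomorph.Set.univ I).symm.trans (Homeomorph.setCongr ha'.symm)).prodCongr
        (Homeomorph.refl T))
    exact ⟨((split S).prodCongr (Homeomorph.refl T)).trans <|
      (Homeomorph.prodAssoc _ _ _).trans <| (rest.prodCongr last).trans <|
      (Homeomorph.prodAssoc _ _ _).symm.trans <|
      ((split S').symm.prodCongr (Homeomorph.refl T)).trans e'⟩

/-- The product of finitely many proper factors is a set in the product space. -/
def univPiHomeomorph {ι : Type*} {Y : ι → Type*} [∀ i, TopologicalSpace (Y i)]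
    (S : ∀ i, Set (Y i)) : ↥(univ.pi S) ≃ₜ ∀ i, ↥(S i) where
  toFun f i := ⟨f.1 i, f.2 i trivial⟩
  invFun g := ⟨fun i => g i, fun i _ => (g i).2⟩
  left_inv _ := rfl
  right_inv _ := rfl
  continuous_toFun := continuous_pi fun i =>
    Continuous.subtype_mk ((continuous_apply i).comp continuous_subtype_val) _
  continuous_invFun := by fun_prop

lemma nonempty_homeomorph_nat_ne (j : ℕ) : Nonempty (({i // i ≠ j} → I) ≃ₜ (ℕ → I)) := by
  have : Infinite {i // i ≠ j} := (Set.finite_singleton j).infinite_compl.to_subtype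
  obtain ⟨e⟩ := nonempty_equiv_of_countable (α := {i // i ≠ j}) (β := ℕ)
  exact ⟨Homeomorph.piCongrLeft (Y := fun _ => I) e⟩

lemma locallyModeledOn_hilbertCube : LocallyModeledOn HilbertCube HilbertHalfOpen := by
  classical
  intro x U hU
  obtain ⟨O, hOU, hO, hxO⟩ := mem_nhds_iff.1 hU
  obtain ⟨F, u, hu, huO⟩ := isOpen_pi_iff.1 hO x hxO
  obtain ⟨j, hj⟩ := Infinite.exists_notMem_finset F
  choose! A hA hAu hAT using fun i (hi : i ∈ F) =>
    exists_nhds_prod_homeomorph (x i) ((hu i hi).1.mem_nhds (hu i hi).2)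
  obtain ⟨B, hB, ⟨eB⟩⟩ := exists_nhds_homeomorph_Ici (x j)
  let S : ℕ → Set I := fun i => if i ∈ F then A i else if i = j then B else univ
  have hSF : ∀ i ∈ F, S i = A i := fun i hi => if_pos hi
  have hSj : S j = B := by simp [S, hj]
  have hSn : ∀ i, i ∉ F → i ≠ j → S i = univ := fun i hi hij => by simp [S, hi, hij]
  refine ⟨univ.pi S, ?_, ?_, ?_⟩
  · have : univ.pi S = (↑(insert j F) : Set ℕ).pi S := by
      refine (pi_mono' (fun i _ => le_rfl) (subset_univ _)).antisymm fun y hy i _ => ?_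
      by_cases hi : i ∈ insert j F
      · exact hy i hi
      · rw [hSn i (fun h => hi (by simp [h])) (fun h => hi (by simp [h]))]
        trivial
    rw [this]
    refine set_pi_mem_nhds (Finset.finite_toSet _) fun i hi => ?_
    rcases Finset.mem_insert.1 hi with rfl | hi
    · rwa [hSj]
    · rw [hSF i hi]
      exact hA i hi
  · exact fun y hy => hOU (huO fun i hi => hAu i hi (hSF i hi ▸ hy i trivial))
  · obtain ⟨e⟩ := nonempty_pi_prod_homeomorph (T := ↥(Ici (0 : ℝ))) (F.subtype (· ≠ j))
      (fun i => S i) (fun i hi => by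
        rw [hSF i (Finset.mem_subtype.1 hi)]
        exact hAT i (Finset.mem_subtype.1 hi))
      (fun i hi => hSn i (fun h => hi (Finset.mem_subtype.2 h)) i.2)
    obtain ⟨e'⟩ := nonempty_homeomorph_nat_ne j
    exact ⟨(univPiHomeomorph S).trans <| (Homeomorph.piSplitAt j fun i => ↥(S i)).trans <|
      (((Homeomorph.setCongr hSj).trans eB).prodCongr (Homeomorph.refl _)).trans <|
      (Homeomorph.prodComm _ _).trans <| e.trans (e'.prodCongr halfLineHomeomorphIco)⟩

/-- Proposition: members of a tame family in a metrizable space are point-like (if `X` is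
completely metrizable), cell-like (if `X` is locally contractible), and cellular (if `X`
is a manifold modeled on `ℝ^n` or on the Hilbert cube). -/
theorem tame_member_shape (X : Type*) [TopologicalSpace X]
    [TopologicalSpace.MetrizableSpace X] (𝒦 : Set (Set X)) (h𝒦 : IsTameFamily 𝒦) :
    ∀ K ∈ 𝒦,
      (CompletelyMetrizable X → PointLike K) ∧
      (LocallyContractible X → CellLike K) ∧
      ((∀ n : ℕ, IsManifoldModeledOn X (Fin n → ℝ) → CellularIn (Fin n → ℝ) K) ∧
        (IsManifoldModeledOn X HilbertCube → CellularIn HilbertHalfOpen K)) := by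
  obtain ⟨hcompact, hinv, hshrink, -, -⟩ := h𝒦
  refine fun K hK => ⟨?_, (hshrink K hK).cellLike, fun n hX => ?_, fun hX => ?_⟩
  · rintro ⟨m, rfl, _⟩
    exact pointLike_of_locallyShrinkable (hcompact K hK) fun h => hshrink _ (hinv h K hK)
  · exact (hshrink K hK).cellularIn (hX.locallyModeledOn (locallyModeledOn_self _))
  · exact (hshrink K hK).cellularIn (hX.locallyModeledOn locallyModeledOn_hilbertCube)

end
end
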